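/- arXiv:1605.04694 — 3 statements merged into one kernel-verified Lean document; each statement's English description precedes it below -/
import Mathlib

section
/- Let P ⊂ ℝ³ be a 3-dimensional simple integral convex polytope and F a facet of P with vertices P_1, …, P_r in cyclic order and adjacent facets F_{k_1}, …, F_{k_r} (F_{k_i} meeting F along the edge P_{i−1}P_i). Then the rational number C(F) computed from this labeling is unchanged under any cyclic rotation of the labeling, i.e., C(F) does not depend on which adjacent facet is chosen as F_{k_1}. -/
open scoped Pointwise

noncomputable section

/-- The real vector corresponding to an integer vector. -/
def toR (v : Fin 3 → ℤ) : Fin 3 → ℝ := fun i => (v i : ℝ)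

/-- The standard inner product on `ℝ³`. -/
def inner3 (u v : Fin 3 → ℝ) : ℝ := ∑ i, u i * v i

/-- The determinant of the 3×3 matrix whose columns are the vectors `u, v, w ∈ ℝ³`. -/
def det3 (u v w : Fin 3 → ℝ) : ℝ := Matrix.det (Matrix.transpose (Matrix.of ![u, v, w]))

/-- A vector in `ℤ³` is primitive if the gcd of its coordinates is `1`. -/
def IsPrimitive (v : Fin 3 → ℤ) : Prop := Int.gcd (v 0) (Int.gcd (v 1) (v 2)) = 1

/-- The gcd of the coordinates of an integer vector. -/
def gcd3 (v : Fin 3 → ℤ) : ℕ := Int.gcd (v 0) (Int.gcd (v 1) (v 2))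

/-- `toR` as an additive group homomorphism. -/
def toRhom : (Fin 3 → ℤ) →+ (Fin 3 → ℝ) where
  toFun := toR
  map_zero' := by funext i; simp [toR]
  map_add' x y := by funext i; simp [toR]

/-- The lattice `(ℝv + ℝw) ∩ ℤ³`, as an additive subgroup of `ℤ³`. -/
def planeLattice (v w : Fin 3 → ℤ) : AddSubgroup (Fin 3 → ℤ) :=
  AddSubgroup.comap toRhom (Submodule.span ℝ {toR v, toR w}).toAddSubgroup

/-- `m(E)` for an edge `E = F ∩ F'` with primitive inward normals `v, w`:
the index `|((ℝv + ℝw) ∩ ℤ³)/(ℤv + ℤw)|`. -/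
def mIndex (v w : Fin 3 → ℤ) : ℕ :=
  ((AddSubgroup.closure ({v, w} : Set (Fin 3 → ℤ))).addSubgroupOf (planeLattice v w)).index

/-- A (nonempty exposed) face of `P ⊂ ℝ³`. -/
def IsFaceOf (P F : Set (Fin 3 → ℝ)) : Prop :=
  F.Nonempty ∧ ∃ w : Fin 3 → ℝ, F = {x ∈ P | ∀ y ∈ P, inner3 w y ≤ inner3 w x}

/-- The dimension of a face, i.e. the rank of the direction of its affine span. -/
def faceDim (F : Set (Fin 3 → ℝ)) : ℕ := Module.finrank ℝ (vectorSpan ℝ F)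

/-- `x` is a vertex of `P`, i.e. `{x}` is a face of `P`. -/
def IsVertexOf (P : Set (Fin 3 → ℝ)) (x : Fin 3 → ℝ) : Prop := IsFaceOf P {x}

/-- `E` is an edge of `P`, i.e. a face of dimension `1`. -/
def IsEdgeOf (P E : Set (Fin 3 → ℝ)) : Prop := IsFaceOf P E ∧ faceDim E = 1

/-- `F` is a facet of `P`, i.e. a face of dimension `2`. -/
def IsFacetOf (P F : Set (Fin 3 → ℝ)) : Prop := IsFaceOf P F ∧ faceDim F = 2

/-- A 3-dimensional polytope is simple if every vertex lies on exactly `3` facets. -/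
def IsSimple (P : Set (Fin 3 → ℝ)) : Prop :=
  ∀ x : Fin 3 → ℝ, IsVertexOf P x → {F : Set (Fin 3 → ℝ) | IsFacetOf P F ∧ x ∈ F}.ncard = 3

/-- `v` is the inward-pointing primitive integral normal vector of the facet `F` of `P`. -/
def IsInwardNormal (P F : Set (Fin 3 → ℝ)) (v : Fin 3 → ℤ) : Prop :=
  IsPrimitive v ∧ ∀ u ∈ F, ∀ u' ∈ P, 0 ≤ inner3 (toR v) (u' - u)

/-- `ε_i = det(v, v_{k_{i+1}}, v_{k_i})`. -/
def epsF (vF : Fin 3 → ℤ) (vk : ℕ → Fin 3 → ℤ) (i : ℕ) : ℝ :=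
  det3 (toR vF) (toR (vk (i + 1))) (toR (vk i))

/-- `a_i = ⟨P_{i-1}Q_{i-1}, v_{k_{i+1}}⟩ / (ε_i ⟨P_{i-1}Q_{i-1}, v⟩)`. -/
def aF (vF : Fin 3 → ℤ) (vk : ℕ → Fin 3 → ℤ) (Pt : ℕ → Fin 3 → ℤ) (Q : ℕ → Fin 3 → ℝ)
    (i : ℕ) : ℝ :=
  inner3 (Q (i - 1) - toR (Pt (i - 1))) (toR (vk (i + 1))) /
    (epsF vF vk i * inner3 (Q (i - 1) - toR (Pt (i - 1))) (toR vF))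

/-- `b_i = ⟨P_iP_{i+1}, v_{k_{i-1}}⟩ / (ε_{i-1} ⟨P_iP_{i+1}, v_{k_i}⟩)`. -/
def bF (vF : Fin 3 → ℤ) (vk : ℕ → Fin 3 → ℤ) (Pt : ℕ → Fin 3 → ℤ) (i : ℕ) : ℝ :=
  inner3 (toR (Pt (i + 1)) - toR (Pt i)) (toR (vk (i - 1))) /
    (epsF vF vk (i - 1) * inner3 (toR (Pt (i + 1)) - toR (Pt i)) (toR (vk i)))

/-- `triDet b ε s t` is the determinant of the tridiagonal matrix with diagonal entries
`b s, …, b t` and sub- and super-diagonal entries `(ε s)⁻¹, …, (ε (t-1))⁻¹`, with the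
convention `triDet b ε s t = 1` when `s > t`. -/
def triDet (b ε : ℕ → ℝ) (s t : ℕ) : ℝ :=
  if t < s then 1
  else Matrix.det (Matrix.of fun k l : Fin (t + 1 - s) =>
    if (k : ℕ) = (l : ℕ) then b (s + (k : ℕ))
    else if (k : ℕ) + 1 = (l : ℕ) ∨ (l : ℕ) + 1 = (k : ℕ) then
      (ε (s + min (k : ℕ) (l : ℕ)))⁻¹
    else 0)

/-- `C(F) = -∑_{2 ≤ i < j ≤ r} a_i D(i+1, j-1) ε_i ε_{i+1} ⋯ ε_{j-1}
Vol(P_{j-1}P_j)/m(P_{j-1}P_j)`, computed from the labeling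
(vertices `Pt`, adjacent facet normals `vk`, points `Q`) around a facet with
inward primitive normal `vF` and `r` vertices. -/
def CFacet (vF : Fin 3 → ℤ) (Pt : ℕ → Fin 3 → ℤ) (vk : ℕ → Fin 3 → ℤ) (Q : ℕ → Fin 3 → ℝ)
    (r : ℕ) : ℝ :=
  -∑ i ∈ Finset.Icc 2 r, ∑ j ∈ Finset.Icc (i + 1) r,
      aF vF vk Pt Q i * triDet (bF vF vk Pt) (epsF vF vk) (i + 1) (j - 1) *
        (∏ k ∈ Finset.Icc i (j - 1), epsF vF vk k) *
        ((gcd3 (Pt j - Pt (j - 1)) : ℝ) / (mIndex vF (vk j) : ℝ))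

/-- A labeling of the vertices `P_1, …, P_r` (in cyclic order), the adjacent facets
`F_{k_1}, …, F_{k_r}` (`F_{k_i}` meets `F` along the edge `P_{i-1}P_i`), their inward
primitive normals `v_{k_1}, …, v_{k_r}`, and the points `Q_1, …, Q_r` (`Q_i` is the endpoint
other than `P_i` of the unique edge of `P` emanating from `P_i` not contained in `F`)
around a facet `F` of `P` with inward primitive normal `vF`; all data is indexed by `ℕ`,
periodically with period `r`. -/
structure FacetLabeling (P F : Set (Fin 3 → ℝ)) (vF : Fin 3 → ℤ) (r : ℕ)
    (Pt : ℕ → Fin 3 → ℤ) (Fk : ℕ → Set (Fin 3 → ℝ)) (vk : ℕ → Fin 3 → ℤ)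
    (Q : ℕ → Fin 3 → ℝ) : Prop where
  three_le : 3 ≤ r
  Pt_periodic : ∀ i, Pt (i + r) = Pt i
  Fk_periodic : ∀ i, Fk (i + r) = Fk i
  vk_periodic : ∀ i, vk (i + r) = vk i
  Q_periodic : ∀ i, Q (i + r) = Q i
  Pt_injOn : ∀ i ∈ Finset.Icc 1 r, ∀ j ∈ Finset.Icc 1 r, Pt i = Pt j → i = j
  Pt_vertex : ∀ i ∈ Finset.Icc 1 r, IsVertexOf P (toR (Pt i))
  F_eq_hull : F = convexHull ℝ ((fun i => toR (Pt i)) '' Set.Icc 1 r)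
  Fk_facet : ∀ i ∈ Finset.Icc 1 r, IsFacetOf P (Fk i)
  Fk_meets_F : ∀ i ∈ Finset.Icc 1 r, F ∩ Fk i = segment ℝ (toR (Pt (i - 1))) (toR (Pt i))
  vk_normal : ∀ i ∈ Finset.Icc 1 r, IsInwardNormal P (Fk i) (vk i)
  Q_edge : ∀ i ∈ Finset.Icc 1 r,
    IsEdgeOf P (segment ℝ (toR (Pt i)) (Q i)) ∧ Q i ∉ F ∧ Q i ≠ toR (Pt i)

/-! ### Linear algebra -/

/-- The linear functional `x ↦ ⟨u, x⟩`. -/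
def innerL (u : Fin 3 → ℝ) : (Fin 3 → ℝ) →ₗ[ℝ] ℝ where
  toFun x := inner3 u x
  map_add' x y := by simp [inner3, Fin.sum_univ_three]; ring
  map_smul' c x := by simp [inner3, Fin.sum_univ_three]; ring

lemma innerL_apply (u x : Fin 3 → ℝ) : innerL u x = inner3 u x := rfl

lemma inner3_sub (u x y : Fin 3 → ℝ) : inner3 u (x - y) = inner3 u x - inner3 u y :=
  (innerL u).map_sub x y

lemma inner3_comm (u x : Fin 3 → ℝ) : inner3 u x = inner3 x u := by
  simp [inner3, Fin.sum_univ_three]; ring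

lemma innerL_ne_zero {u : Fin 3 → ℝ} (hu : u ≠ 0) : innerL u ≠ 0 := by
  intro h
  apply hu
  funext i
  have := congrArg (fun f => f (Pi.single i 1)) h
  simpa [innerL, inner3, Pi.single_apply] using this

lemma finrank_ker_innerL {u : Fin 3 → ℝ} (hu : u ≠ 0) :
    Module.finrank ℝ (LinearMap.ker (innerL u)) = 2 := by
  have := Module.Dual.finrank_ker_add_one_of_ne_zero (f := innerL u) (innerL_ne_zero hu)
  simp at this
  omega

lemma vectorSpan_le_ker {A : Set (Fin 3 → ℝ)} {u p : Fin 3 → ℝ} (hp : p ∈ A)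
    (h : ∀ x ∈ A, inner3 u x = inner3 u p) : vectorSpan ℝ A ≤ LinearMap.ker (innerL u) := by
  rw [vectorSpan_eq_span_vsub_set_right ℝ hp, Submodule.span_le]
  rintro _ ⟨x, hx, rfl⟩
  simp [innerL_apply, inner3_sub, h x hx]

lemma toR_ne_zero {v : Fin 3 → ℤ} (hv : IsPrimitive v) : toR v ≠ 0 := by
  intro h
  have h0 : ∀ i, v i = 0 := fun i => by simpa [toR] using congrFun h i
  simp [IsPrimitive, h0] at hv

/-! ### Facets, edges, vertices -/

lemma facet_mem {P F : Set (Fin 3 → ℝ)} {v : Fin 3 → ℤ} (hF : IsFacetOf P F)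
    (hv : IsInwardNormal P F v) {x y : Fin 3 → ℝ} (hx : x ∈ F) (hy : y ∈ P)
    (h : inner3 (toR v) y = inner3 (toR v) x) : y ∈ F := by
  obtain ⟨⟨-, w, hw⟩, hdim⟩ := hF
  have hFP : ∀ z ∈ F, z ∈ P := fun z hz => by rw [hw] at hz; exact hz.1
  have hmax : ∀ z ∈ F, ∀ y ∈ P, inner3 w y ≤ inner3 w z := fun z hz => by
    rw [hw] at hz; exact hz.2
  have h1 : vectorSpan ℝ F ≤ LinearMap.ker (innerL (toR v)) := by
    apply vectorSpan_le_ker hx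
    intro z hz
    have a := hv.2 x hx z (hFP z hz)
    have b := hv.2 z hz x (hFP x hx)
    rw [inner3_sub] at a b
    linarith
  have h2 : vectorSpan ℝ F ≤ LinearMap.ker (innerL w) := by
    apply vectorSpan_le_ker hx
    intro z hz
    exact le_antisymm (hmax x hx z (hFP z hz)) (hmax z hz x (hFP x hx))
  have h3 : vectorSpan ℝ F = LinearMap.ker (innerL (toR v)) := by
    apply Submodule.eq_of_le_of_finrank_eq h1
    rw [finrank_ker_innerL (toR_ne_zero hv.1)]
    exact hdim
  have h4 : y - x ∈ LinearMap.ker (innerL (toR v)) := by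
    rw [LinearMap.mem_ker, innerL_apply, inner3_sub, h, sub_self]
  rw [← h3] at h4
  have h5 := h2 h4
  have h6 : inner3 w y = inner3 w x := by
    have : inner3 w (y - x) = 0 := h5
    rw [inner3_sub] at this
    linarith
  rw [hw]
  exact ⟨hy, fun z hz => by rw [h6]; exact hmax x hx z hz⟩

lemma facet_subset {P F : Set (Fin 3 → ℝ)} (hF : IsFaceOf P F) : F ⊆ P := by
  obtain ⟨-, w, hw⟩ := hF
  rw [hw]; exact fun x hx => hx.1

lemma vertex_mem {P : Set (Fin 3 → ℝ)} {x : Fin 3 → ℝ} (h : IsVertexOf P x) : x ∈ P :=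
  facet_subset h rfl

lemma vertex_not_mem_segment {P : Set (Fin 3 → ℝ)} {x a b : Fin 3 → ℝ} (h : IsVertexOf P x)
    (ha : a ∈ P) (hb : b ∈ P) (hxa : x ≠ a) (hxb : x ≠ b) : x ∉ segment ℝ a b := by
  rintro ⟨s, t, hs, ht, hst, hx⟩
  obtain ⟨-, w, hw⟩ := h
  have hxx : x ∈ ({x} : Set (Fin 3 → ℝ)) := rfl
  rw [hw] at hxx
  have key : ∀ y ∈ P, x ≠ y → inner3 w y < inner3 w x := by
    intro y hy hne
    refine lt_of_le_of_ne (hxx.2 y hy) fun he => hne ?_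
    have : y ∈ ({x} : Set (Fin 3 → ℝ)) := by
      rw [hw]; exact ⟨hy, fun z hz => by rw [he]; exact hxx.2 z hz⟩
    exact this.symm
  have e : inner3 w x = s * inner3 w a + t * inner3 w b := by
    rw [← hx]
    have := (innerL w).map_add (s • a) (t • b)
    simpa [innerL_apply, map_smul] using this
  have ka := key a ha hxa
  have kb := key b hb hxb
  have : s = 1 - t := by linarith
  subst this
  rcases eq_or_lt_of_le ht with h0 | h0
  · subst h0; linarith
  · nlinarith

lemma full_zero {P : Set (Fin 3 → ℝ)} (hfull : affineSpan ℝ P = ⊤) {u p : Fin 3 → ℝ}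
    (hp : p ∈ P) (h : ∀ x ∈ P, inner3 u x = inner3 u p) : u = 0 := by
  by_contra hu
  have h1 := vectorSpan_le_ker hp h
  rw [AffineSubspace.vectorSpan_eq_top_of_affineSpan_eq_top _ _ _ hfull] at h1
  have h2 := finrank_ker_innerL hu
  rw [top_le_iff.mp h1] at h2
  simp at h2

lemma edge_facet_aux {S : Set (Fin 3 → ℝ)} (hS : S.Finite) {P : Set (Fin 3 → ℝ)}
    (hP : P = convexHull ℝ S) (hfull : affineSpan ℝ P = ⊤)
    {p q w z : Fin 3 → ℝ}
    (hE : segment ℝ p q = {x ∈ P | ∀ y ∈ P, inner3 w y ≤ inner3 w x})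
    (hpq : q ≠ p) (hw : w ≠ 0) (hz : inner3 z q = inner3 z p)
    (hind : ∀ c : ℝ, z + c • w ≠ 0) :
    ∃ m : ℝ, (∀ x ∈ P, m * (inner3 w p - inner3 w x) ≤ inner3 z x - inner3 z p) ∧
      IsFacetOf P {x ∈ P | inner3 z x - inner3 z p = m * (inner3 w p - inner3 w x)} := by
  have hpE : p ∈ segment ℝ p q := left_mem_segment ℝ p q
  have hqE : q ∈ segment ℝ p q := right_mem_segment ℝ p q
  have hp : p ∈ P ∧ ∀ y ∈ P, inner3 w y ≤ inner3 w p := by rw [hE] at hpE; exact hpE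
  have hq : q ∈ P ∧ ∀ y ∈ P, inner3 w y ≤ inner3 w q := by rw [hE] at hqE; exact hqE
  have hwpq : inner3 w q = inner3 w p := le_antisymm (hp.2 q hq.1) (hq.2 p hp.1)
  have hSP : S ⊆ P := by rw [hP]; exact subset_convexHull ℝ S
  have hzE : ∀ x ∈ P, inner3 w x = inner3 w p → inner3 z x = inner3 z p := by
    intro x hx hxw
    have : x ∈ segment ℝ p q := by
      rw [hE]; exact ⟨hx, fun y hy => by rw [hxw]; exact hp.2 y hy⟩
    obtain ⟨s, t, hs, ht, hst, rfl⟩ := this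
    have := (innerL z).map_add (s • p) (t • q)
    simp only [map_smul, innerL_apply, smul_eq_mul] at this
    rw [this, hz]
    have : s = 1 - t := by linarith
    subst this; ring
  have hne : ({s ∈ S | inner3 w s < inner3 w p}).Nonempty := by
    by_contra hcon
    rw [Set.not_nonempty_iff_eq_empty] at hcon
    apply hw
    apply full_zero hfull hp.1
    intro x hx
    refine le_antisymm (hp.2 x hx) ?_
    have : convexHull ℝ S ⊆ {x | inner3 w p ≤ innerL w x} := by
      apply convexHull_min
      · intro s hs
        by_contra hlt
        have : s ∈ {s ∈ S | inner3 w s < inner3 w p} := ⟨hs, not_le.mp hlt⟩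
        rw [hcon] at this
        exact this
      · exact convex_halfSpace_ge (innerL w).isLinear _
    rw [← hP] at this
    exact this hx
  obtain ⟨s1, ⟨hs1S, hs1⟩, hmin⟩ := Set.exists_min_image _
    (fun s => (inner3 z s - inner3 z p) / (inner3 w p - inner3 w s))
    (hS.subset (Set.sep_subset S _)) hne
  set m := (inner3 z s1 - inner3 z p) / (inner3 w p - inner3 w s1) with hm
  have hadd : ∀ x, inner3 (z + m • w) x = inner3 z x + m * inner3 w x := by
    intro x; simp [inner3, Fin.sum_univ_three]; ring
  have hge : ∀ x ∈ P, m * (inner3 w p - inner3 w x) ≤ inner3 z x - inner3 z p := by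
    have : convexHull ℝ S ⊆ {x | inner3 (z + m • w) p ≤ innerL (z + m • w) x} := by
      apply convexHull_min
      · intro s hs
        simp only [Set.mem_ofPred_eq, innerL_apply, hadd]
        rcases eq_or_lt_of_le (hp.2 s (hSP hs)) with h | h
        · rw [h, hzE s (hSP hs) h]
        · have := hmin s ⟨hs, h⟩
          rw [le_div_iff₀ (by linarith)] at this
          linarith
      · exact convex_halfSpace_ge (innerL _).isLinear _
    rw [← hP] at this
    intro x hx
    have := this hx
    simp only [Set.mem_ofPred_eq, innerL_apply, hadd] at this
    linarith
  refine ⟨m, hge, ⟨⟨p, hp.1, by ring⟩, -(z + m • w), ?_⟩, ?_⟩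
  · have hneg : ∀ x, inner3 (-(z + m • w)) x = -(inner3 z x + m * inner3 w x) := by
      intro x; rw [← hadd]; simp [inner3, Fin.sum_univ_three]; ring
    ext x
    simp only [Set.mem_ofPred_eq, hneg]
    constructor
    · rintro ⟨hx, h⟩
      exact ⟨hx, fun y hy => by have := hge y hy; linarith⟩
    · rintro ⟨hx, h⟩
      exact ⟨hx, by have := h p hp.1; have := hge x hx; linarith⟩
  · unfold faceDim
    set G := {x ∈ P | inner3 z x - inner3 z p = m * (inner3 w p - inner3 w x)} with hG
    have hpG : p ∈ G := ⟨hp.1, by ring⟩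
    have hqG : q ∈ G := ⟨hq.1, by rw [hz, hwpq]; ring⟩
    have hsG : s1 ∈ G := ⟨hSP hs1S, by
      rw [hm, div_mul_cancel₀]; linarith⟩
    apply le_antisymm
    · rw [← finrank_ker_innerL (hind m)]
      apply Submodule.finrank_mono
      apply vectorSpan_le_ker hpG
      intro x hx
      rw [hadd, hadd]
      have := hx.2
      linarith
    · have hli : LinearIndependent ℝ ![q - p, s1 - p] := by
        rw [LinearIndependent.pair_iff]
        intro a b hab
        have h1 : inner3 w (a • (q - p) + b • (s1 - p)) = 0 := by
          rw [hab]; simp [inner3]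
        have h2 : inner3 w (a • (q - p) + b • (s1 - p)) =
            a * (inner3 w q - inner3 w p) + b * (inner3 w s1 - inner3 w p) := by
          have := (innerL w).map_add (a • (q - p)) (b • (s1 - p))
          simpa only [map_smul, innerL_apply, smul_eq_mul, inner3_sub] using this
        rw [h2, hwpq] at h1
        have hb : b = 0 := by
          have : b * (inner3 w s1 - inner3 w p) = 0 := by linarith
          rcases mul_eq_zero.mp this with h | h
          · exact h
          · linarith
        subst hb
        simp only [zero_smul, add_zero, smul_eq_zero, sub_eq_zero] at hab
        exact ⟨hab.resolve_right hpq, rfl⟩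
      have := finrank_span_eq_card hli
      have h2 : 2 = Module.finrank ℝ (Submodule.span ℝ (Set.range ![q - p, s1 - p])) := by
        rw [this]; simp
      rw [h2]
      apply Submodule.finrank_mono
      rw [Submodule.span_le]
      rintro _ ⟨i, rfl⟩
      fin_cases i
      · exact vsub_mem_vectorSpan ℝ hqG hpG
      · exact vsub_mem_vectorSpan ℝ hsG hpG

lemma edge_two_facets {S : Set (Fin 3 → ℝ)} (hS : S.Finite) {P : Set (Fin 3 → ℝ)}
    (hP : P = convexHull ℝ S) (hfull : affineSpan ℝ P = ⊤)
    {p q : Fin 3 → ℝ} (hE : IsEdgeOf P (segment ℝ p q)) (hpq : q ≠ p) :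
    ∃ G G' : Set (Fin 3 → ℝ), IsFacetOf P G ∧ IsFacetOf P G' ∧ G ≠ G' ∧
      p ∈ G ∧ q ∈ G ∧ p ∈ G' ∧ q ∈ G' := by
  obtain ⟨⟨-, w, hw⟩, hdim⟩ := hE
  have hpE : p ∈ segment ℝ p q := left_mem_segment ℝ p q
  have hqE : q ∈ segment ℝ p q := right_mem_segment ℝ p q
  have hp : p ∈ P ∧ ∀ y ∈ P, inner3 w y ≤ inner3 w p := by rw [hw] at hpE; exact hpE
  have hq : q ∈ P ∧ ∀ y ∈ P, inner3 w y ≤ inner3 w q := by rw [hw] at hqE; exact hqE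
  have hwpq : inner3 w q = inner3 w p := le_antisymm (hp.2 q hq.1) (hq.2 p hp.1)
  have hw0 : w ≠ 0 := by
    rintro rfl
    have : segment ℝ p q = P := by
      rw [hw]; ext x; simp [inner3]
    rw [this, faceDim, AffineSubspace.vectorSpan_eq_top_of_affineSpan_eq_top _ _ _ hfull] at hdim
    simp at hdim
  set z : Fin 3 → ℝ := crossProduct w (q - p) with hzdef
  have hzq : inner3 z q = inner3 z p := by
    simp [hzdef, inner3, Fin.sum_univ_three, cross_apply]; ring
  have hzw : inner3 w z = 0 := by
    simp [hzdef, inner3, Fin.sum_univ_three, cross_apply]; ring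
  have hpos : ∀ x : Fin 3 → ℝ, inner3 x x = 0 → x = 0 := by
    intro x hx
    simp only [inner3, Fin.sum_univ_three] at hx
    have h0 : x 0 = 0 := by nlinarith [mul_self_nonneg (x 0), mul_self_nonneg (x 1), mul_self_nonneg (x 2)]
    have h1 : x 1 = 0 := by nlinarith [mul_self_nonneg (x 0), mul_self_nonneg (x 1), mul_self_nonneg (x 2)]
    have h2 : x 2 = 0 := by nlinarith [mul_self_nonneg (x 0), mul_self_nonneg (x 1), mul_self_nonneg (x 2)]
    funext i; fin_cases i <;> simp [h0, h1, h2]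
  have hz0 : z ≠ 0 := by
    intro h0
    have h1 : inner3 z z = inner3 w w * inner3 (q - p) (q - p) - (inner3 w (q - p)) ^ 2 := by
      simp [hzdef, inner3, Fin.sum_univ_three, cross_apply]; ring
    rw [inner3_sub w, hwpq, sub_self, h0] at h1
    have h2 : inner3 w w * inner3 (q - p) (q - p) = 0 := by
      have : inner3 0 0 = 0 := by simp [inner3]
      rw [this] at h1; linarith
    rcases mul_eq_zero.mp h2 with h | h
    · exact hw0 (hpos _ h)
    · exact hpq (sub_eq_zero.mp (hpos _ h))
  have hind : ∀ c : ℝ, z + c • w ≠ 0 := by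
    intro c hc
    apply hz0
    apply hpos
    have h1 : inner3 z (z + c • w) = inner3 z z + c * inner3 w z := by
      simp [inner3, Fin.sum_univ_three]; ring
    rw [hc, hzw] at h1
    have : inner3 z 0 = 0 := by simp [inner3]
    linarith
  have hneg : ∀ x, inner3 (-z) x = - inner3 z x := by
    intro x; simp [inner3]
  have hind' : ∀ c : ℝ, -z + c • w ≠ 0 := by
    intro c hc
    apply hind (-c)
    have := congrArg (fun x => -x) hc
    simpa [add_comm] using this
  obtain ⟨m, hm, hf⟩ := edge_facet_aux hS hP hfull hw hpq hw0 hzq hind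
  obtain ⟨m', hm', hf'⟩ := edge_facet_aux hS hP hfull hw hpq hw0
    (z := -z) (by rw [hneg, hneg, hzq]) hind'
  refine ⟨_, _, hf, hf', ?_, ⟨hp.1, by ring⟩, ⟨hq.1, by rw [hzq, hwpq]; ring⟩,
    ⟨hp.1, by ring⟩, ⟨hq.1, by rw [hneg, hneg, hzq, hwpq]; ring⟩⟩
  intro heq
  by_cases hmm : m + m' = 0
  · apply hind m
    apply full_zero hfull hp.1
    intro x hx
    have h1 := hm x hx
    have h2 := hm' x hx
    rw [hneg, hneg] at h2
    have hadd : ∀ x, inner3 (z + m • w) x = inner3 z x + m * inner3 w x := by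
      intro x; simp [inner3, Fin.sum_univ_three]; ring
    have : m' = -m := by linarith
    subst this
    rw [hadd, hadd]
    linarith
  · have hsub : {x ∈ P | inner3 z x - inner3 z p = m * (inner3 w p - inner3 w x)} ⊆
        segment ℝ p q := by
      intro x hx
      have hx' := hx
      rw [heq] at hx'
      have h1 := hx.2
      have h2 := hx'.2
      rw [hneg, hneg] at h2
      have h3 : (m + m') * (inner3 w p - inner3 w x) = 0 := by linarith
      have h4 := (mul_eq_zero.mp h3).resolve_left hmm
      rw [hw]
      exact ⟨hx.1, fun y hy => by have := hp.2 y hy; linarith⟩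
    have := Submodule.finrank_mono (vectorSpan_mono ℝ hsub)
    have h1 := hf.2
    unfold faceDim at h1 hdim
    omega

/-! ### Lattice index -/

lemma gcd3_dvd (v : Fin 3 → ℤ) (i : Fin 3) : (gcd3 v : ℤ) ∣ v i := by
  unfold gcd3
  have h0 : (Int.gcd (v 0) (Int.gcd (v 1) (v 2)) : ℤ) ∣ v 0 := Int.gcd_dvd_left _ _
  have h : (Int.gcd (v 0) (Int.gcd (v 1) (v 2)) : ℤ) ∣ (Int.gcd (v 1) (v 2) : ℤ) :=
    Int.gcd_dvd_right _ _
  fin_cases i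
  · exact h0
  · exact h.trans (Int.gcd_dvd_left _ _)
  · exact h.trans (Int.gcd_dvd_right _ _)

lemma gcd3_bezout (v : Fin 3 → ℤ) :
    ∃ a : Fin 3 → ℤ, a 0 * v 0 + a 1 * v 1 + a 2 * v 2 = gcd3 v := by
  have h1 := Int.gcd_eq_gcd_ab (v 1) (v 2)
  have h2 := Int.gcd_eq_gcd_ab (v 0) (Int.gcd (v 1) (v 2))
  refine ⟨![Int.gcdA (v 0) (Int.gcd (v 1) (v 2)),
    Int.gcdB (v 0) (Int.gcd (v 1) (v 2)) * Int.gcdA (v 1) (v 2),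
    Int.gcdB (v 0) (Int.gcd (v 1) (v 2)) * Int.gcdB (v 1) (v 2)], ?_⟩
  unfold gcd3
  rw [h2]
  simp only [Matrix.cons_val_zero, Matrix.cons_val_one, Matrix.cons_val]
  linear_combination (-Int.gcdB (v 0) (Int.gcd (v 1) (v 2))) * h1

lemma gcd3_smul (c : ℤ) (v : Fin 3 → ℤ) : gcd3 (c • v) = c.natAbs * gcd3 v := by
  unfold gcd3
  simp only [Pi.smul_apply, smul_eq_mul, Int.gcd_eq_natAbs_gcd_natAbs, Int.natAbs_mul,
    Int.natAbs_natCast, Nat.gcd_mul_left]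

/-- The integral cross product. -/
def icross (v w : Fin 3 → ℤ) : Fin 3 → ℤ :=
  ![v 1 * w 2 - v 2 * w 1, v 2 * w 0 - v 0 * w 2, v 0 * w 1 - v 1 * w 0]

lemma gcd3_ne_zero {v : Fin 3 → ℤ} (hv : v ≠ 0) : gcd3 v ≠ 0 := by
  intro h
  apply hv
  funext i
  have := gcd3_dvd v i
  rw [h] at this
  simpa using this

lemma exists_primitive {n : Fin 3 → ℤ} (hn : n ≠ 0) :
    ∃ n0 : Fin 3 → ℤ, n = (gcd3 n : ℤ) • n0 ∧ gcd3 n0 = 1 := by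
  choose n0 hn0 using gcd3_dvd n
  have h : n = (gcd3 n : ℤ) • n0 := by
    funext i; simpa using hn0 i
  refine ⟨n0, h, ?_⟩
  have h1 := gcd3_smul (gcd3 n : ℤ) n0
  rw [← h, Int.natAbs_natCast] at h1
  have h2 := gcd3_ne_zero hn
  exact (Nat.eq_of_mul_eq_mul_left (Nat.pos_of_ne_zero h2) (by rw [mul_one]; exact h1)).symm

lemma mIndex_eq {v w : Fin 3 → ℤ} (hv : IsPrimitive v) (hn : icross v w ≠ 0) :
    mIndex v w = gcd3 (icross v w) := by
  obtain ⟨n0, hn0, hp⟩ := exists_primitive hn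
  set g := gcd3 (icross v w) with hg
  have hg0 : g ≠ 0 := gcd3_ne_zero hn
  obtain ⟨a, ha⟩ := gcd3_bezout v
  obtain ⟨b, hb⟩ := gcd3_bezout n0
  rw [hp] at hb
  rw [show gcd3 v = 1 from hv] at ha
  push_cast at ha hb
  have c0 : v 1 * w 2 - v 2 * w 1 = g * n0 0 := by simpa [icross] using congrFun hn0 0
  have c1 : v 2 * w 0 - v 0 * w 2 = g * n0 1 := by simpa [icross] using congrFun hn0 1
  have c2 : v 0 * w 1 - v 1 * w 0 = g * n0 2 := by simpa [icross] using congrFun hn0 2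
  have horth : v 0 * n0 0 + v 1 * n0 1 + v 2 * n0 2 = 0 := by
    have : (g : ℤ) * (v 0 * n0 0 + v 1 * n0 1 + v 2 * n0 2) = 0 := by
      linear_combination (-v 0) * c0 + (-v 1) * c1 + (-v 2) * c2
    exact (mul_eq_zero.mp this).resolve_left (by exact_mod_cast hg0)
  let f0 : (Fin 3 → ℤ) →+ ℤ :=
    { toFun := fun x => b 0 * (v 1 * x 2 - v 2 * x 1) + b 1 * (v 2 * x 0 - v 0 * x 2) +
        b 2 * (v 0 * x 1 - v 1 * x 0)
      map_zero' := by simp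
      map_add' := fun x y => by simp only [Pi.add_apply]; ring }
  have f0_apply : ∀ x, f0 x = b 0 * (v 1 * x 2 - v 2 * x 1) + b 1 * (v 2 * x 0 - v 0 * x 2) +
        b 2 * (v 0 * x 1 - v 1 * x 0) := fun x => rfl
  let f : planeLattice v w →+ ℤ := f0.comp (planeLattice v w).subtype
  have f_apply : ∀ x, f x = f0 x := fun x => rfl
  have hL : ∀ x ∈ planeLattice v w, v 1 * x 2 - v 2 * x 1 = f0 x * n0 0 ∧
      v 2 * x 0 - v 0 * x 2 = f0 x * n0 1 ∧ v 0 * x 1 - v 1 * x 0 = f0 x * n0 2 := by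
    intro x hx
    have hx' : toR x ∈ Submodule.span ℝ {toR v, toR w} := hx
    obtain ⟨α, β, hab⟩ := Submodule.mem_span_pair.mp hx'
    have x0 : α * v 0 + β * w 0 = (x 0 : ℝ) := by simpa [toR] using congrFun hab 0
    have x1 : α * v 1 + β * w 1 = (x 1 : ℝ) := by simpa [toR] using congrFun hab 1
    have x2 : α * v 2 + β * w 2 = (x 2 : ℝ) := by simpa [toR] using congrFun hab 2
    have c0' : (v 1 * w 2 - v 2 * w 1 : ℝ) = g * n0 0 := by exact_mod_cast c0
    have c1' : (v 2 * w 0 - v 0 * w 2 : ℝ) = g * n0 1 := by exact_mod_cast c1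
    have c2' : (v 0 * w 1 - v 1 * w 0 : ℝ) = g * n0 2 := by exact_mod_cast c2
    have hb' : (b 0 * n0 0 + b 1 * n0 1 + b 2 * n0 2 : ℝ) = 1 := by exact_mod_cast hb
    have d0 : (v 1 * x 2 - v 2 * x 1 : ℝ) = β * g * n0 0 := by
      rw [← x1, ← x2]; linear_combination β * c0'
    have d1 : (v 2 * x 0 - v 0 * x 2 : ℝ) = β * g * n0 1 := by
      rw [← x0, ← x2]; linear_combination β * c1'
    have d2 : (v 0 * x 1 - v 1 * x 0 : ℝ) = β * g * n0 2 := by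
      rw [← x0, ← x1]; linear_combination β * c2'
    have hf : (f0 x : ℝ) = β * g := by
      rw [f0_apply]; push_cast
      rw [d0, d1, d2]
      linear_combination β * g * hb'
    rw [← hf] at d0 d1 d2
    exact ⟨by exact_mod_cast d0, by exact_mod_cast d1, by exact_mod_cast d2⟩
  have hfw : f0 w = g := by
    rw [f0_apply, c0, c1, c2]; linear_combination (g : ℤ) * hb
  have hfv : f0 v = 0 := by rw [f0_apply]; ring
  have hsurj : Function.Surjective f := by
    intro k
    let x : Fin 3 → ℤ := ![n0 1 * a 2 - n0 2 * a 1, n0 2 * a 0 - n0 0 * a 2,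
      n0 0 * a 1 - n0 1 * a 0]
    have x0 : x 0 = n0 1 * a 2 - n0 2 * a 1 := rfl
    have x1 : x 1 = n0 2 * a 0 - n0 0 * a 2 := rfl
    have x2 : x 2 = n0 0 * a 1 - n0 1 * a 0 := rfl
    have hx0 : v 1 * x 2 - v 2 * x 1 = n0 0 := by
      rw [x1, x2]; linear_combination (-a 0) * horth + n0 0 * ha
    have hx1 : v 2 * x 0 - v 0 * x 2 = n0 1 := by
      rw [x0, x2]; linear_combination (-a 1) * horth + n0 1 * ha
    have hx2 : v 0 * x 1 - v 1 * x 0 = n0 2 := by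
      rw [x0, x1]; linear_combination (-a 2) * horth + n0 2 * ha
    have hxL : x ∈ planeLattice v w := by
      change toR x ∈ Submodule.span ℝ {toR v, toR w}
      rw [Submodule.mem_span_pair]
      have hgR : (g : ℝ) ≠ 0 := by exact_mod_cast hg0
      have ha' : (a 0 * v 0 + a 1 * v 1 + a 2 * v 2 : ℝ) = 1 := by exact_mod_cast ha
      have e0 : (g * (v 1 * x 2 - v 2 * x 1) : ℝ) = v 1 * w 2 - v 2 * w 1 := by
        exact_mod_cast (by rw [hx0, c0])
      have e1 : (g * (v 2 * x 0 - v 0 * x 2) : ℝ) = v 2 * w 0 - v 0 * w 2 := by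
        exact_mod_cast (by rw [hx1, c1])
      have e2 : (g * (v 0 * x 1 - v 1 * x 0) : ℝ) = v 0 * w 1 - v 1 * w 0 := by
        exact_mod_cast (by rw [hx2, c2])
      refine ⟨(a 0 * (x 0 - w 0 / g) + a 1 * (x 1 - w 1 / g) + a 2 * (x 2 - w 2 / g) : ℝ),
        1 / g, ?_⟩
      funext i
      fin_cases i
      · simp [toR]; field_simp
        linear_combination (a 1) * e2 - (a 2) * e1 + (g * x 0 - w 0) * ha'
      · simp [toR]; field_simp
        linear_combination (a 2) * e0 - (a 0) * e2 + (g * x 1 - w 1) * ha'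
      · simp [toR]; field_simp
        linear_combination (a 0) * e1 - (a 1) * e0 + (g * x 2 - w 2) * ha'
    refine ⟨k • ⟨x, hxL⟩, ?_⟩
    rw [map_zsmul, f_apply]
    change k • f0 x = k
    rw [f0_apply, hx0, hx1, hx2, hb]; simp
  have hcomap : (AddSubgroup.closure ({v, w} : Set (Fin 3 → ℤ))).addSubgroupOf
      (planeLattice v w) = (AddSubgroup.zmultiples (g : ℤ)).comap f := by
    ext x
    rw [AddSubgroup.mem_addSubgroupOf, AddSubgroup.mem_comap, f_apply,
      AddSubgroup.mem_closure_pair, AddSubgroup.mem_zmultiples_iff]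
    constructor
    · rintro ⟨m, n, hx⟩
      refine ⟨n, ?_⟩
      rw [← hx, map_add, map_zsmul, map_zsmul, hfv, hfw]; simp
    · rintro ⟨k, hk⟩
      obtain ⟨h0, h1, h2⟩ := hL x x.2
      rw [← hk] at h0 h1 h2
      simp only [smul_eq_mul] at h0 h1 h2
      set y : Fin 3 → ℤ := (x : Fin 3 → ℤ) with hy
      refine ⟨a 0 * (y 0 - k * w 0) + a 1 * (y 1 - k * w 1) + a 2 * (y 2 - k * w 2), k, ?_⟩
      funext i
      fin_cases i
      · simp
        linear_combination (a 1) * (h2 - k * c2) - (a 2) * (h1 - k * c1) + (y 0 - k * w 0) * ha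
      · simp
        linear_combination (a 2) * (h0 - k * c0) - (a 0) * (h2 - k * c2) + (y 1 - k * w 1) * ha
      · simp
        linear_combination (a 0) * (h1 - k * c1) - (a 1) * (h0 - k * c0) + (y 2 - k * w 2) * ha
  unfold mIndex
  rw [hcomap, AddSubgroup.index_comap_of_surjective _ hsurj, Int.index_zmultiples,
    Int.natAbs_natCast]

/-- `Vol(E)/m(E)` is the absolute value of the ratio of the edge vector and `v × w`. -/
lemma gcd3_div_mIndex {v w D : Fin 3 → ℤ} (hv : IsPrimitive v) (hn : icross v w ≠ 0)
    {l : ℝ} (hD : ∀ i, (D i : ℝ) = l * (icross v w i : ℝ)) :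
    (gcd3 D : ℝ) / (mIndex v w : ℝ) = |l| := by
  rw [mIndex_eq hv hn]
  obtain ⟨n0, hn0, hp⟩ := exists_primitive hn
  set n := icross v w
  have hg0 : (gcd3 n : ℝ) ≠ 0 := by exact_mod_cast gcd3_ne_zero hn
  obtain ⟨b, hb⟩ := gcd3_bezout n0
  rw [hp] at hb
  push_cast at hb
  have hb' : (b 0 * n0 0 + b 1 * n0 1 + b 2 * n0 2 : ℝ) = 1 := by exact_mod_cast hb
  have hni : ∀ i, (n i : ℝ) = gcd3 n * n0 i := fun i => by
    have := congrFun hn0 i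
    simp only [Pi.smul_apply, smul_eq_mul] at this
    exact_mod_cast this
  set c : ℤ := b 0 * D 0 + b 1 * D 1 + b 2 * D 2 with hc
  have hcR : (c : ℝ) = l * gcd3 n := by
    rw [hc]; push_cast
    rw [hD, hD, hD, hni, hni, hni]
    linear_combination l * gcd3 n * hb'
  have hDc : D = c • n0 := by
    funext i
    have : (D i : ℝ) = c * n0 i := by rw [hD, hcR, hni]; ring
    simp only [Pi.smul_apply, smul_eq_mul]
    exact_mod_cast this
  have h1 : gcd3 D = c.natAbs := by rw [hDc, gcd3_smul, hp, mul_one]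
  rw [h1, Nat.cast_natAbs, Int.cast_abs, hcR, abs_mul, Nat.abs_cast]
  field_simp

/-! ### Tridiagonal determinants -/

/-- The tridiagonal matrix of size `n` starting at index `s`. -/
def triM (b ε : ℕ → ℝ) (s n : ℕ) : Matrix (Fin n) (Fin n) ℝ :=
  Matrix.of fun k l : Fin n =>
    if (k : ℕ) = (l : ℕ) then b (s + (k : ℕ))
    else if (k : ℕ) + 1 = (l : ℕ) ∨ (l : ℕ) + 1 = (k : ℕ) then
      (ε (s + min (k : ℕ) (l : ℕ)))⁻¹
    else 0

lemma triDet_eq (b ε : ℕ → ℝ) (s t : ℕ) : triDet b ε s t = (triM b ε s (t + 1 - s)).det := by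
  unfold triDet
  split_ifs with h
  · have h0 : t + 1 - s = 0 := by omega
    rw [h0]; simp
  · rfl

lemma triM_succ (b ε : ℕ → ℝ) (s n : ℕ) :
    (triM b ε s (n + 1)).submatrix Fin.succ Fin.succ = triM b ε (s + 1) n := by
  ext k l
  simp only [triM, Matrix.submatrix_apply, Matrix.of_apply, Fin.val_succ, add_left_inj]
  rw [show s + (↑k + 1) = s + 1 + (k : ℕ) by ring,
    show s + min ((k : ℕ) + 1) (↑l + 1) = s + 1 + min (k : ℕ) l by omega]

lemma det_triM_zero (b ε : ℕ → ℝ) (s : ℕ) : (triM b ε s 0).det = 1 := by simp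

lemma det_triM_one (b ε : ℕ → ℝ) (s : ℕ) : (triM b ε s 1).det = b s := by
  simp [triM]

lemma det_triM_rec (b ε : ℕ → ℝ) (s n : ℕ) :
    (triM b ε s (n + 2)).det = b s * (triM b ε (s + 1) (n + 1)).det -
      (ε s)⁻¹ ^ 2 * (triM b ε (s + 2) n).det := by
  rw [Matrix.det_succ_row_zero, Fin.sum_univ_succ, Fin.sum_univ_succ, Finset.sum_eq_zero]
  · have h1 : ((triM b ε s (n + 2)).submatrix Fin.succ ((0 : Fin (n + 2)).succAbove)).det =
        (triM b ε (s + 1) (n + 1)).det := by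
      rw [← triM_succ]; congr 2
    have h2 : ((triM b ε s (n + 2)).submatrix Fin.succ
        ((Fin.succ 0 : Fin (n + 2)).succAbove)).det =
        (ε s)⁻¹ * (triM b ε (s + 2) n).det := by
      rw [Matrix.det_succ_column_zero, Fin.sum_univ_succ, Finset.sum_eq_zero]
      · have h3 : (((triM b ε s (n + 2)).submatrix Fin.succ
            ((Fin.succ 0 : Fin (n + 2)).succAbove)).submatrix
              ((0 : Fin (n + 1)).succAbove) Fin.succ) = triM b ε (s + 2) n := by
          rw [show s + 2 = s + 1 + 1 by ring, ← triM_succ, ← triM_succ]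
          ext k l
          simp [Matrix.submatrix_apply]
        rw [h3]
        simp [triM]
      · intro i _
        simp [triM]
    rw [h1, h2]
    simp [triM]
    ring
  · intro i _
    simp [triM]

/-! ### Algebra -/

lemma det3_eq (u v w : Fin 3 → ℝ) : det3 u v w =
    u 0 * (v 1 * w 2 - v 2 * w 1) + u 1 * (v 2 * w 0 - v 0 * w 2) +
      u 2 * (v 0 * w 1 - v 1 * w 0) := by
  simp [det3, Matrix.det_fin_three]; ring

/-- Three term relation modulo `v`. -/
lemma three_term (v x w0 w1 w2 : Fin 3 → ℝ) (h0 : det3 v w1 w0 ≠ 0) (h1 : det3 v w2 w1 ≠ 0) :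
    (det3 v w1 w0)⁻¹ * det3 v x w0 =
      det3 v w2 w0 / (det3 v w1 w0 * det3 v w2 w1) * det3 v x w1 -
        (det3 v w2 w1)⁻¹ * det3 v x w2 := by
  field_simp
  simp only [det3_eq]
  ring

/-- Telescoping relation. -/
lemma tele_rel (v x w0 w1 w2 : Fin 3 → ℝ) (h0 : det3 v w1 w0 ≠ 0) (h1 : det3 v w2 w1 ≠ 0) :
    -det3 w0 w1 w2 / (det3 v w1 w0 * det3 v w2 w1) * det3 v x w1 =
      (det3 v w2 w1)⁻¹ * det3 w2 x w1 - (det3 v w1 w0)⁻¹ * det3 w1 x w0 := by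
  field_simp
  simp only [det3_eq]
  ring

lemma triDet_prod (v : Fin 3 → ℝ) (w : ℕ → Fin 3 → ℝ) (b ε : ℕ → ℝ)
    (hε : ∀ i, ε i = det3 v (w (i + 1)) (w i)) (hε0 : ∀ i, ε i ≠ 0)
    (hb : ∀ i, b (i + 1) = det3 v (w (i + 2)) (w i) / (ε i * ε (i + 1))) (n : ℕ) :
    ∀ i, (triM b ε (i + 1) n).det * ∏ k ∈ Finset.range (n + 1), ε (i + k) =
      det3 v (w (i + n + 1)) (w i) := by
  induction n using Nat.strong_induction_on with
  | _ n ih =>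
    intro i
    match n, ih with
    | 0, _ => rw [det_triM_zero]; simp [hε]
    | 1, _ =>
      rw [det_triM_one, hb]
      simp only [Finset.prod_range_succ, Finset.prod_range_zero, add_zero, one_mul]
      have h0 := hε0 i
      have h1 := hε0 (i + 1)
      field_simp
    | n + 2, ih =>
      have e1 := ih (n + 1) (by omega) (i + 1)
      have e2 := ih n (by omega) (i + 2)
      have ht := three_term v (w (i + (n + 2) + 1)) (w i) (w (i + 1)) (w (i + 2))
        (by rw [← hε]; exact hε0 i) (by rw [← hε]; exact hε0 (i + 1))
      rw [← hε, ← hε (i + 1), ← hb] at ht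
      rw [det_triM_rec]
      rw [show i + 1 + (n + 1) + 1 = i + (n + 2) + 1 by ring] at e1
      rw [show i + 2 + n + 1 = i + (n + 2) + 1 by ring] at e2
      rw [← e1, ← e2] at ht
      rw [Finset.prod_range_succ' _ (n + 2), Finset.prod_range_succ' _ (n + 1)]
      rw [Finset.prod_range_succ' _ (n + 1)] at ht
      simp only [add_zero] at ht ⊢
      have q1 : ∀ k, ε (i + 1 + (k + 1)) = ε (i + (k + 1 + 1)) := fun k => by congr 1; ring
      have q2 : ∀ k, ε (i + 2 + k) = ε (i + (k + 1 + 1)) := fun k => by congr 1; ring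
      simp only [q1, q2] at ht
      have h0 := hε0 i
      have h1 := hε0 (i + 1)
      have : det3 v (w (i + (n + 2) + 1)) (w i) =
          ε i * ((ε i)⁻¹ * det3 v (w (i + (n + 2) + 1)) (w i)) := by field_simp
      rw [this, ht]
      simp only [show i + 1 + 1 = i + 2 by ring, show i + (0 + 1) = i + 1 by ring]
      field_simp

/-- Combinatorial rotation invariance. -/
lemma tri_sum_rot (r : ℕ) (hr : 1 ≤ r) (G : ℕ → ℕ → ℝ)
    (hdiag : ∀ i, G i i = 0)
    (hper : ∀ i j, G i (j + 1 + r) = G i (j + 1))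
    (hrow : ∀ i s, ∑ j ∈ Finset.range r, G i (s + 1 + j) = 0)
    (hcol : ∀ j s, ∑ i ∈ Finset.range r, G (s + 1 + i) j = 0) (t : ℕ) :
    ∑ i ∈ Finset.Icc 2 r, ∑ j ∈ Finset.Icc (i + 1) r, G (i + t) (j + t) =
      ∑ i ∈ Finset.Icc 2 r, ∑ j ∈ Finset.Icc (i + 1) r, G i j := by
  have step1 : ∀ t, ∑ i ∈ Finset.Icc 2 r, ∑ j ∈ Finset.Icc (i + 1) r, G (i + t) (j + t) =
      ∑ i ∈ Finset.Icc 1 r, ∑ j ∈ Finset.Icc (i + 1) r, G (i + t) (j + t) := by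
    intro t
    rw [← Finset.sum_erase_add (Finset.Icc 1 r) _ (Finset.mem_Icc.mpr ⟨le_refl 1, hr⟩)]
    have h1 : (Finset.Icc 1 r).erase 1 = Finset.Icc 2 r := by
      ext x; simp; omega
    have h2 : ∑ j ∈ Finset.Icc (1 + 1) r, G (1 + t) (j + t) = 0 := by
      have h3 := hrow (1 + t) t
      rw [add_comm t 1] at h3
      obtain ⟨m, rfl⟩ : ∃ m, r = m + 1 := ⟨r - 1, by omega⟩
      rw [Finset.sum_range_succ', add_zero, hdiag, add_zero] at h3
      rw [← h3, ← Finset.Ico_add_one_right_eq_Icc, Finset.sum_Ico_eq_sum_range]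
      apply Finset.sum_congr (by congr 1)
      intro k _
      congr 1; ring
    rw [h1, h2, add_zero]
  have step2 : ∀ t, ∑ i ∈ Finset.Icc 2 r, ∑ j ∈ Finset.Icc (i + 1) r, G (i + (t + 1)) (j + (t + 1)) =
      ∑ i ∈ Finset.Icc 2 r, ∑ j ∈ Finset.Icc (i + 1) r, G (i + t) (j + t) := by
    intro t
    -- the shifted sum, written over `2 ≤ i ≤ r + 1`, `i < j ≤ r + 1`
    have hA : ∑ i ∈ Finset.Icc 1 r, ∑ j ∈ Finset.Icc (i + 1) r, G (i + (t + 1)) (j + (t + 1)) =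
        ∑ i ∈ Finset.Icc 2 (r + 1), ∑ j ∈ Finset.Icc (i + 1) (r + 1), G (i + t) (j + t) := by
      rw [← Finset.Ico_add_one_right_eq_Icc, ← Finset.Ico_add_one_right_eq_Icc 2 (r + 1),
        ← Finset.sum_Ico_add' _ 1 (r + 1) 1]
      apply Finset.sum_congr rfl
      intro i _
      rw [← Finset.Ico_add_one_right_eq_Icc, ← Finset.Ico_add_one_right_eq_Icc _ (r + 1),
        ← Finset.sum_Ico_add' _ (i + 1) (r + 1) 1]
      apply Finset.sum_congr rfl
      intro j _
      congr 1 <;> ring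
    rw [step1 (t + 1), hA]
    rw [Finset.sum_Icc_succ_top (by omega)]
    rw [Finset.Icc_eq_empty (by omega : ¬ r + 1 + 1 ≤ r + 1), Finset.sum_empty, add_zero]
    have hB : ∀ i ∈ Finset.Icc 2 r, ∑ j ∈ Finset.Icc (i + 1) (r + 1), G (i + t) (j + t) =
        ∑ j ∈ Finset.Icc (i + 1) r, G (i + t) (j + t) + G (i + t) (r + 1 + t) := by
      intro i hi
      rw [Finset.mem_Icc] at hi
      rw [Finset.sum_Icc_succ_top (by omega)]
    rw [Finset.sum_congr rfl hB, Finset.sum_add_distrib]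
    have hC : ∑ i ∈ Finset.Icc 2 r, G (i + t) (r + 1 + t) = 0 := by
      have h3 := hcol (1 + t) t
      rw [add_comm t 1] at h3
      have h4 : ∀ i, G i (r + 1 + t) = G i (1 + t) := fun i => by
        rw [add_comm 1 t, ← hper i t]; congr 1; ring
      simp only [h4]
      obtain ⟨m, rfl⟩ : ∃ m, r = m + 1 := ⟨r - 1, by omega⟩
      rw [Finset.sum_range_succ', add_zero, hdiag, add_zero] at h3
      rw [← h3, ← Finset.Ico_add_one_right_eq_Icc, Finset.sum_Ico_eq_sum_range]
      apply Finset.sum_congr (by congr 1)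
      intro k _
      congr 1; ring
    rw [hC, add_zero]
  induction t with
  | zero => simp
  | succ t ih => rw [step2, ih]

/-! ### Facts about a labeling, and the algebraic core -/

/-- The real cross product. -/
def rcross (v w : Fin 3 → ℝ) : Fin 3 → ℝ :=
  ![v 1 * w 2 - v 2 * w 1, v 2 * w 0 - v 0 * w 2, v 0 * w 1 - v 1 * w 0]

lemma toR_icross (v w : Fin 3 → ℤ) : toR (icross v w) = rcross (toR v) (toR w) := by
  funext i; fin_cases i <;> simp [toR, icross, rcross]

lemma inner3_smul_rcross (l : ℝ) (v w x : Fin 3 → ℝ) :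
    inner3 (l • rcross v w) x = l * det3 v w x := by
  simp [inner3, Fin.sum_univ_three, rcross, det3_eq]; ring

lemma exists_smul_rcross {u w D : Fin 3 → ℝ} (hn : rcross u w ≠ 0)
    (hu : inner3 u D = 0) (hw : inner3 w D = 0) : ∃ l : ℝ, D = l • rcross u w := by
  set n := rcross u w with hnd
  have n0 : n 0 = u 1 * w 2 - u 2 * w 1 := rfl
  have n1 : n 1 = u 2 * w 0 - u 0 * w 2 := rfl
  have n2 : n 2 = u 0 * w 1 - u 1 * w 0 := rfl
  simp only [inner3, Fin.sum_univ_three] at hu hw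
  have hN : n 0 ^ 2 + n 1 ^ 2 + n 2 ^ 2 ≠ 0 := by
    intro h
    apply hn
    have h0 : n 0 = 0 := by nlinarith [sq_nonneg (n 0), sq_nonneg (n 1), sq_nonneg (n 2)]
    have h1 : n 1 = 0 := by nlinarith [sq_nonneg (n 0), sq_nonneg (n 1), sq_nonneg (n 2)]
    have h2 : n 2 = 0 := by nlinarith [sq_nonneg (n 0), sq_nonneg (n 1), sq_nonneg (n 2)]
    funext i; fin_cases i <;> simp [h0, h1, h2]
  have c0 : D 1 * n 2 - D 2 * n 1 = 0 := by
    rw [n1, n2]; linear_combination u 0 * hw - w 0 * hu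
  have c1 : D 2 * n 0 - D 0 * n 2 = 0 := by
    rw [n0, n2]; linear_combination u 1 * hw - w 1 * hu
  have c2 : D 0 * n 1 - D 1 * n 0 = 0 := by
    rw [n0, n1]; linear_combination u 2 * hw - w 2 * hu
  refine ⟨(D 0 * n 0 + D 1 * n 1 + D 2 * n 2) / (n 0 ^ 2 + n 1 ^ 2 + n 2 ^ 2), ?_⟩
  funext i
  simp only [Pi.smul_apply, smul_eq_mul]
  rw [div_mul_eq_mul_div, eq_div_iff hN]
  fin_cases i
  · simp; linear_combination n 1 * c2 - n 2 * c1
  · simp; linear_combination n 2 * c0 - n 0 * c2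
  · simp; linear_combination n 0 * c1 - n 1 * c0

/-- The incidence facts about a labeling which are used. -/
structure Facts (vF : Fin 3 → ℤ) (Pt vk : ℕ → Fin 3 → ℤ) (Q : ℕ → Fin 3 → ℝ) : Prop where
  prim : IsPrimitive vF
  ha : ∀ i, inner3 (toR vF) (toR (Pt (i + 1)) - toR (Pt i)) = 0
  hb : ∀ i, inner3 (toR (vk (i + 1))) (toR (Pt (i + 1)) - toR (Pt i)) = 0
  hc : ∀ i, 0 < inner3 (toR (vk i)) (toR (Pt (i + 1)) - toR (Pt i))
  hd : ∀ i, inner3 (toR (vk (i + 2))) (toR (Pt (i + 1)) - toR (Pt i)) < 0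
  he1 : ∀ i, inner3 (toR (vk i)) (Q i - toR (Pt i)) = 0
  he2 : ∀ i, inner3 (toR (vk (i + 1))) (Q i - toR (Pt i)) = 0
  he3 : ∀ i, inner3 (toR vF) (Q i - toR (Pt i)) ≠ 0

lemma Facts.shift {vF : Fin 3 → ℤ} {Pt vk : ℕ → Fin 3 → ℤ} {Q : ℕ → Fin 3 → ℝ}
    (h : Facts vF Pt vk Q) (t : ℕ) :
    Facts vF (fun i => Pt (i + t)) (fun i => vk (i + t)) (fun i => Q (i + t)) where
  prim := h.prim
  ha i := by simpa only [Nat.add_right_comm i _ t] using h.ha (i + t)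
  hb i := by simpa only [Nat.add_right_comm i _ t] using h.hb (i + t)
  hc i := by simpa only [Nat.add_right_comm i _ t] using h.hc (i + t)
  hd i := by simpa only [Nat.add_right_comm i _ t] using h.hd (i + t)
  he1 i := by simpa only [Nat.add_right_comm i _ t] using h.he1 (i + t)
  he2 i := by simpa only [Nat.add_right_comm i _ t] using h.he2 (i + t)
  he3 i := by simpa only [Nat.add_right_comm i _ t] using h.he3 (i + t)

section core

variable {vF : Fin 3 → ℤ} {Pt vk : ℕ → Fin 3 → ℤ} {Q : ℕ → Fin 3 → ℝ}

lemma Facts.cross_ne (h : Facts vF Pt vk Q) (i : ℕ) : icross vF (vk i) ≠ 0 := by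
  intro h0
  have h1 := toR_icross vF (vk i)
  rw [h0] at h1
  have c0 := congrFun h1 0
  have c1 := congrFun h1 1
  have c2 := congrFun h1 2
  simp only [rcross] at c0 c1 c2
  simp only [toR, Pi.zero_apply, Int.cast_zero, Matrix.cons_val_zero, Matrix.cons_val_one,
    Matrix.cons_val] at c0 c1 c2
  have ha := h.ha i
  have hc := h.hc i
  set D := toR (Pt (i + 1)) - toR (Pt i)
  apply hc.ne'
  simp only [inner3, Fin.sum_univ_three, toR] at ha ⊢
  have hv := toR_ne_zero h.prim
  have : ∃ j, (vF j : ℝ) ≠ 0 := by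
    by_contra hcon
    push Not at hcon
    exact hv (funext hcon)
  obtain ⟨j, hj⟩ := this
  apply mul_left_cancel₀ hj
  rw [mul_zero]
  fin_cases j
  · simp only [Fin.zero_eta, Fin.mk_one, Fin.reduceFinMk]
    linear_combination (vk i 0 : ℝ) * ha - D 1 * c2 + D 2 * c1
  · simp only [Fin.zero_eta, Fin.mk_one, Fin.reduceFinMk]
    linear_combination (vk i 1 : ℝ) * ha - D 2 * c0 + D 0 * c2
  · simp only [Fin.zero_eta, Fin.mk_one, Fin.reduceFinMk]
    linear_combination (vk i 2 : ℝ) * ha - D 0 * c1 + D 1 * c0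

lemma Facts.exists_l (h : Facts vF Pt vk Q) : ∃ l : ℕ → ℝ, ∀ i,
    toR (Pt (i + 1)) - toR (Pt i) = l i • rcross (toR vF) (toR (vk (i + 1))) := by
  have : ∀ i, ∃ l : ℝ,
      toR (Pt (i + 1)) - toR (Pt i) = l • rcross (toR vF) (toR (vk (i + 1))) := by
    intro i
    apply exists_smul_rcross _ (h.ha i) (h.hb i)
    rw [← toR_icross]
    intro h0
    apply h.cross_ne (i + 1)
    funext j
    simpa [toR] using congrFun h0 j
  choose l hl using this
  exact ⟨l, hl⟩

lemma Facts.sign (h : Facts vF Pt vk Q) {l : ℕ → ℝ} (hl : ∀ i,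
    toR (Pt (i + 1)) - toR (Pt i) = l i • rcross (toR vF) (toR (vk (i + 1)))) (i : ℕ) :
    0 < l i * epsF vF vk i ∧ 0 < l i * epsF vF vk (i + 1) := by
  have hc := h.hc i
  have hd := h.hd i
  rw [inner3_comm, hl, inner3_smul_rcross] at hc hd
  refine ⟨hc, ?_⟩
  have : det3 (toR vF) (toR (vk (i + 1))) (toR (vk (i + 2))) = - epsF vF vk (i + 1) := by
    simp only [epsF, det3_eq]; ring
  rw [this] at hd
  linarith

lemma Facts.eps_ne (h : Facts vF Pt vk Q) (i : ℕ) : epsF vF vk i ≠ 0 := by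
  obtain ⟨l, hl⟩ := h.exists_l
  have := (h.sign hl i).1
  intro h0
  rw [h0] at this
  simp at this

lemma Facts.bF_eq (h : Facts vF Pt vk Q) (i : ℕ) : bF vF vk Pt (i + 1) =
    det3 (toR vF) (toR (vk (i + 2))) (toR (vk i)) / (epsF vF vk i * epsF vF vk (i + 1)) := by
  obtain ⟨l, hl⟩ := h.exists_l
  have hs := (h.sign hl (i + 1)).1
  have hl0 : l (i + 1) ≠ 0 := fun h0 => by rw [h0] at hs; simp at hs
  have e0 := h.eps_ne i
  have e1 := h.eps_ne (i + 1)
  simp only [bF, Nat.add_sub_cancel]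
  rw [hl (i + 1), inner3_smul_rcross, inner3_smul_rcross]
  change l (i + 1) * det3 (toR vF) (toR (vk (i + 2))) (toR (vk i)) /
    (epsF vF vk i * (l (i + 1) * epsF vF vk (i + 1))) = _
  field_simp

lemma Facts.aF_eq (h : Facts vF Pt vk Q) (i : ℕ) : aF vF vk Pt Q (i + 1) =
    -det3 (toR (vk i)) (toR (vk (i + 1))) (toR (vk (i + 2))) /
      (epsF vF vk i * epsF vF vk (i + 1)) := by
  have e0 := h.eps_ne i
  have e1 := h.eps_ne (i + 1)
  have hdet : det3 (toR (vk i)) (toR (vk (i + 1))) (toR vF) = - epsF vF vk i := by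
    simp only [epsF, det3_eq]; ring
  have hn : rcross (toR (vk i)) (toR (vk (i + 1))) ≠ 0 := by
    intro h0
    have := inner3_smul_rcross 1 (toR (vk i)) (toR (vk (i + 1))) (toR vF)
    rw [h0, hdet] at this
    apply e0
    simpa [inner3] using this
  obtain ⟨m, hm⟩ := exists_smul_rcross hn (h.he1 i) (h.he2 i)
  have h3 := h.he3 i
  rw [inner3_comm, hm, inner3_smul_rcross] at h3
  have hm0 : m ≠ 0 := fun h0 => by rw [h0] at h3; simp at h3
  simp only [aF, Nat.add_sub_cancel]
  rw [hm, inner3_smul_rcross, inner3_smul_rcross, hdet]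
  field_simp

/-- The weight of the edge `P_{j-1}P_j`. -/
def eF (vF : Fin 3 → ℤ) (Pt vk : ℕ → Fin 3 → ℤ) (j : ℕ) : ℝ :=
  (gcd3 (Pt j - Pt (j - 1)) : ℝ) / (mIndex vF (vk j) : ℝ)

lemma Facts.eF_eq (h : Facts vF Pt vk Q) : ∃ σ : ℝ, ∀ j x,
    eF vF Pt vk (j + 1) * det3 (toR vF) (toR (vk (j + 1))) x =
      σ * inner3 (toR (Pt (j + 1)) - toR (Pt j)) x := by
  obtain ⟨l, hl⟩ := h.exists_l
  have hs := h.sign hl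
  have he : ∀ j, eF vF Pt vk (j + 1) = |l j| := by
    intro j
    apply gcd3_div_mIndex h.prim (h.cross_ne (j + 1))
    intro i
    have h1 := congrFun (hl j) i
    rw [← toR_icross] at h1
    simpa [toR] using h1
  rcases lt_or_gt_of_ne (h.eps_ne 0) with h0 | h0
  · have hn : ∀ i, epsF vF vk i < 0 := by
      intro i
      induction i with
      | zero => exact h0
      | succ i ih =>
        have hl' : l i < 0 := by
          by_contra hcon
          nlinarith [(hs i).1]
        by_contra hcon
        nlinarith [(hs i).2]
    refine ⟨-1, fun j x => ?_⟩
    have hl' : l j < 0 := by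
      by_contra hcon
      nlinarith [(hs j).1, hn j]
    rw [he, hl j, inner3_smul_rcross, abs_of_neg hl']; ring
  · have hn : ∀ i, 0 < epsF vF vk i := by
      intro i
      induction i with
      | zero => exact h0
      | succ i ih =>
        have hl' : 0 < l i := by
          by_contra hcon
          nlinarith [(hs i).1]
        by_contra hcon
        nlinarith [(hs i).2]
    refine ⟨1, fun j x => ?_⟩
    have hl' : 0 < l j := by
      by_contra hcon
      nlinarith [(hs j).1, hn j]
    rw [he, hl j, inner3_smul_rcross, abs_of_pos hl']; ring

/-- The simplified summand of `C(F)`. -/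
def GF (vF : Fin 3 → ℤ) (Pt vk : ℕ → Fin 3 → ℤ) (Q : ℕ → Fin 3 → ℝ) (i j : ℕ) : ℝ :=
  aF vF vk Pt Q i * eF vF Pt vk j * det3 (toR vF) (toR (vk j)) (toR (vk i))

lemma Facts.CFacet_eq (h : Facts vF Pt vk Q) (r : ℕ) : CFacet vF Pt vk Q r =
    -∑ i ∈ Finset.Icc 2 r, ∑ j ∈ Finset.Icc (i + 1) r, GF vF Pt vk Q i j := by
  unfold CFacet
  congr 1
  apply Finset.sum_congr rfl
  intro i _
  apply Finset.sum_congr rfl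
  intro j hj
  rw [Finset.mem_Icc] at hj
  obtain ⟨n, rfl⟩ : ∃ n, j = i + n + 1 := ⟨j - i - 1, by omega⟩
  have key := triDet_prod (toR vF) (fun i => toR (vk i)) (bF vF vk Pt) (epsF vF vk)
    (fun i => rfl) h.eps_ne h.bF_eq n i
  rw [triDet_eq]
  have e1 : i + n + 1 - 1 + 1 - (i + 1) = n := by omega
  have e2 : ∏ k ∈ Finset.Icc i (i + n + 1 - 1), epsF vF vk k =
      ∏ k ∈ Finset.range (n + 1), epsF vF vk (i + k) := by
    rw [← Finset.Ico_add_one_right_eq_Icc, Finset.prod_Ico_eq_prod_range]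
    congr 2; omega
  rw [e1, e2, mul_assoc (aF vF vk Pt Q i), key, GF, eF]
  ring

theorem Facts.rotation (h : Facts vF Pt vk Q) {r : ℕ} (hr : 1 ≤ r)
    (hPt : ∀ i, Pt (i + r) = Pt i) (hvk : ∀ i, vk (i + r) = vk i) (t : ℕ) :
    CFacet vF (fun i => Pt (i + t)) (fun i => vk (i + t)) (fun i => Q (i + t)) r =
      CFacet vF Pt vk Q r := by
  rw [(h.shift t).CFacet_eq, h.CFacet_eq]
  congr 1
  rw [← tri_sum_rot r hr (GF vF Pt vk Q) _ _ _ _ t]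
  · apply Finset.sum_congr rfl
    intro i hi
    apply Finset.sum_congr rfl
    intro j hj
    rw [Finset.mem_Icc] at hi hj
    simp only [GF, aF, eF, epsF]
    rw [Nat.add_right_comm i 1 t, show i - 1 + t = i + t - 1 by omega,
      show j - 1 + t = j + t - 1 by omega]
  · intro i
    simp only [GF, det3_eq]; ring
  · intro i j
    simp only [GF, eF, hvk, hPt]
    rw [show j + 1 + r - 1 = j + r by omega, hPt, Nat.add_sub_cancel]
  · intro i s
    obtain ⟨σ, hσ⟩ := h.eF_eq
    have : ∀ j, GF vF Pt vk Q i (s + 1 + j) = aF vF vk Pt Q i * σ *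
        (inner3 (toR (vk i)) (toR (Pt (s + (j + 1)))) - inner3 (toR (vk i)) (toR (Pt (s + j)))) := by
      intro j
      rw [show s + 1 + j = s + j + 1 by ring, GF, mul_assoc, hσ, inner3_comm, inner3_sub,
        show s + (j + 1) = s + j + 1 by ring]
      ring
    simp only [this]
    rw [← Finset.mul_sum, Finset.sum_range_sub (fun j => inner3 (toR (vk i)) (toR (Pt (s + j))))]
    simp [hPt]
  · intro j s
    have : ∀ i, GF vF Pt vk Q (s + 1 + i) j = eF vF Pt vk j *
        ((epsF vF vk (s + (i + 1)))⁻¹ *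
            det3 (toR (vk (s + (i + 1) + 1))) (toR (vk j)) (toR (vk (s + (i + 1)))) -
          (epsF vF vk (s + i))⁻¹ *
            det3 (toR (vk (s + i + 1))) (toR (vk j)) (toR (vk (s + i)))) := by
      intro i
      rw [show s + 1 + i = s + i + 1 by ring, GF, h.aF_eq]
      have := tele_rel (toR vF) (toR (vk j)) (toR (vk (s + i))) (toR (vk (s + i + 1)))
        (toR (vk (s + i + 2))) (h.eps_ne (s + i)) (h.eps_ne (s + i + 1))
      change _ = eF vF Pt vk j * ((det3 (toR vF) (toR (vk (s + i + 2))) (toR (vk (s + i + 1))))⁻¹ *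
        det3 (toR (vk (s + i + 2))) (toR (vk j)) (toR (vk (s + i + 1))) -
        (det3 (toR vF) (toR (vk (s + i + 1))) (toR (vk (s + i))))⁻¹ *
          det3 (toR (vk (s + i + 1))) (toR (vk j)) (toR (vk (s + i))))
      rw [← this]
      simp only [epsF]
      ring
    simp only [this]
    rw [← Finset.mul_sum, Finset.sum_range_sub (fun i => (epsF vF vk (s + i))⁻¹ *
      det3 (toR (vk (s + i + 1))) (toR (vk j)) (toR (vk (s + i))))]
    simp only [epsF, hvk, Nat.add_right_comm s r 1, add_zero, sub_self, mul_zero]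

end core

/-! ### From a labeling to the facts -/

lemma periodic_all {r : ℕ} (hr : 1 ≤ r) (p : ℕ → Prop) (hp : ∀ i, p (i + r) ↔ p i)
    (h : ∀ i ∈ Finset.Icc 1 r, p i) : ∀ i, p i := by
  intro i
  induction i using Nat.strong_induction_on with
  | _ i ih =>
    rcases Nat.eq_zero_or_pos i with h0 | h0
    · subst h0
      rw [← hp 0, zero_add]
      exact h r (Finset.mem_Icc.mpr ⟨hr, le_refl r⟩)
    · by_cases hi : i ≤ r
      · exact h i (Finset.mem_Icc.mpr ⟨h0, hi⟩)
      · have := (hp (i - r)).mpr (ih (i - r) (by omega))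
        rwa [Nat.sub_add_cancel (by omega)] at this

lemma facts_of_labeling
    (Vs : Finset (Fin 3 → ℤ))
    (P : Set (Fin 3 → ℝ)) (hP : P = convexHull ℝ (toR '' (Vs : Set (Fin 3 → ℤ))))
    (hfull : affineSpan ℝ P = ⊤) (hsimple : IsSimple P)
    (F : Set (Fin 3 → ℝ)) (hF : IsFacetOf P F)
    (vF : Fin 3 → ℤ) (hvF : IsInwardNormal P F vF)
    (r : ℕ) (Pt : ℕ → Fin 3 → ℤ) (Fk : ℕ → Set (Fin 3 → ℝ)) (vk : ℕ → Fin 3 → ℤ)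
    (Q : ℕ → Fin 3 → ℝ)
    (hlab : FacetLabeling P F vF r Pt Fk vk Q) : Facts vF Pt vk Q := by
  have hr3 := hlab.three_le
  have hr : 1 ≤ r := by omega
  have pP := hlab.Pt_periodic
  have pF := hlab.Fk_periodic
  have pv := hlab.vk_periodic
  have pQ := hlab.Q_periodic
  have sw : ∀ i k, i + r + k = i + k + r := fun i k => by ring
  have hvert : ∀ i, IsVertexOf P (toR (Pt i)) :=
    periodic_all hr _ (fun i => by rw [pP]) hlab.Pt_vertex
  have hfac : ∀ i, IsFacetOf P (Fk i) :=
    periodic_all hr _ (fun i => by rw [pF]) hlab.Fk_facet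
  have hnor : ∀ i, IsInwardNormal P (Fk i) (vk i) :=
    periodic_all hr _ (fun i => by rw [pF, pv]) hlab.vk_normal
  have hedge : ∀ i, IsEdgeOf P (segment ℝ (toR (Pt i)) (Q i)) ∧ Q i ∉ F ∧ Q i ≠ toR (Pt i) :=
    periodic_all hr _ (fun i => by rw [pP, pQ]) hlab.Q_edge
  have hmeet : ∀ i, F ∩ Fk (i + 1) = segment ℝ (toR (Pt i)) (toR (Pt (i + 1))) := by
    apply periodic_all hr
    · intro i
      rw [sw, pF, pP, pP]
    · intro i hi
      rw [Finset.mem_Icc] at hi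
      by_cases hir : i = r
      · subst hir
        have := hlab.Fk_meets_F 1 (Finset.mem_Icc.mpr ⟨le_refl 1, hr⟩)
        have h1 := pF 1
        have h2 := pP 1
        have h3 := pP 0
        rw [zero_add] at h3
        rw [add_comm i 1, h1, h2, h3]
        exact this
      · exact hlab.Fk_meets_F (i + 1) (Finset.mem_Icc.mpr ⟨by omega, by omega⟩)
  have hdist : ∀ i, Pt (i + 2) ≠ Pt i ∧ Pt (i + 2) ≠ Pt (i + 1) ∧ Pt i ≠ Pt (i + 1) := by
    apply periodic_all hr
    · intro i
      rw [sw, sw, pP, pP, pP]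
    · intro i hi
      rw [Finset.mem_Icc] at hi
      have inj : ∀ a b, 1 ≤ a → a ≤ r → 1 ≤ b → b ≤ r → a ≠ b → Pt a ≠ Pt b := by
        intro a b h1 h2 h3 h4 hab he
        exact hab (hlab.Pt_injOn a (Finset.mem_Icc.mpr ⟨h1, h2⟩) b
          (Finset.mem_Icc.mpr ⟨h3, h4⟩) he)
      by_cases h1 : i = r
      · subst h1
        rw [add_comm i 2, add_comm i 1, pP, pP]
        refine ⟨inj _ _ ?_ ?_ ?_ ?_ ?_, inj _ _ ?_ ?_ ?_ ?_ ?_, inj _ _ ?_ ?_ ?_ ?_ ?_⟩ <;> omega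
      · by_cases h2 : i + 1 = r
        · rw [show i + 2 = 1 + r by omega, pP]
          refine ⟨inj _ _ ?_ ?_ ?_ ?_ ?_, inj _ _ ?_ ?_ ?_ ?_ ?_, inj _ _ ?_ ?_ ?_ ?_ ?_⟩ <;> omega
        · refine ⟨inj _ _ ?_ ?_ ?_ ?_ ?_, inj _ _ ?_ ?_ ?_ ?_ ?_, inj _ _ ?_ ?_ ?_ ?_ ?_⟩ <;> omega
  have toR_inj : ∀ a b : Fin 3 → ℤ, a ≠ b → toR a ≠ toR b := by
    intro a b hab he
    apply hab
    funext i
    have := congrFun he i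
    simpa [toR] using this
  have hPP : ∀ i, toR (Pt i) ∈ P := fun i => vertex_mem (hvert i)
  have hmem1 : ∀ i, toR (Pt i) ∈ F ∧ toR (Pt i) ∈ Fk (i + 1) := by
    intro i
    have : toR (Pt i) ∈ F ∩ Fk (i + 1) := by rw [hmeet]; exact left_mem_segment ℝ _ _
    exact this
  have hmem2 : ∀ i, toR (Pt (i + 1)) ∈ Fk (i + 1) := by
    intro i
    have : toR (Pt (i + 1)) ∈ F ∩ Fk (i + 1) := by rw [hmeet]; exact right_mem_segment ℝ _ _
    exact this.2
  have hmem0 : ∀ i, toR (Pt i) ∈ Fk i := by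
    intro i
    have := hmem2 (i + r - 1)
    rw [show i + r - 1 + 1 = i + r by omega, pP, pF] at this
    exact this
  have hnot1 : ∀ i, toR (Pt (i + 2)) ∉ Fk (i + 1) := by
    intro i hi
    have h1 : toR (Pt (i + 2)) ∈ F ∩ Fk (i + 1) := ⟨(hmem1 _).1, hi⟩
    rw [hmeet] at h1
    exact vertex_not_mem_segment (hvert (i + 2)) (hPP i) (hPP (i + 1))
      (toR_inj _ _ (hdist i).1) (toR_inj _ _ (hdist i).2.1) h1
  have hnot1' : ∀ i, toR (Pt (i + 1)) ∉ Fk i := by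
    intro i hi
    apply hnot1 (i + r - 1)
    rw [show i + r - 1 + 2 = i + 1 + r by omega, show i + r - 1 + 1 = i + r by omega, pP, pF]
    exact hi
  have hnot2 : ∀ i, toR (Pt i) ∉ Fk (i + 2) := by
    intro i hi
    have h1 : toR (Pt i) ∈ F ∩ Fk (i + 2) := ⟨(hmem1 _).1, hi⟩
    rw [hmeet (i + 1)] at h1
    exact vertex_not_mem_segment (hvert i) (hPP (i + 1)) (hPP (i + 2))
      (toR_inj _ _ (hdist i).2.2) (toR_inj _ _ (hdist i).1.symm) h1
  -- equality on a facet, strictness off it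
  have heq : ∀ {A : Set (Fin 3 → ℝ)} {v : Fin 3 → ℤ}, IsFacetOf P A → IsInwardNormal P A v →
      ∀ x ∈ A, ∀ y ∈ A, inner3 (toR v) (y - x) = 0 := by
    intro A v hA hv x hx y hy
    have a := hv.2 x hx y (facet_subset hA.1 hy)
    have b := hv.2 y hy x (facet_subset hA.1 hx)
    rw [inner3_sub] at a b ⊢
    linarith
  have hlt : ∀ {A : Set (Fin 3 → ℝ)} {v : Fin 3 → ℤ}, IsFacetOf P A → IsInwardNormal P A v →
      ∀ x ∈ A, ∀ y ∈ P, y ∉ A → 0 < inner3 (toR v) (y - x) := by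
    intro A v hA hv x hx y hy hyA
    refine lt_of_le_of_ne (hv.2 x hx y hy) fun h0 => hyA ?_
    apply facet_mem hA hv hx hy
    rw [inner3_sub] at h0
    linarith
  have hQP : ∀ i, Q i ∈ P := fun i =>
    facet_subset (hedge i).1.1 (right_mem_segment ℝ _ _)
  have hQF : ∀ i, Q i ∈ Fk i ∧ Q i ∈ Fk (i + 1) := by
    intro i
    have hcard := hsimple _ (hvert i)
    set T := {G : Set (Fin 3 → ℝ) | IsFacetOf P G ∧ toR (Pt i) ∈ G} with hT
    have d1 : F ≠ Fk i := fun h => hnot1' i (h ▸ (hmem1 (i + 1)).1)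
    have d2 : F ≠ Fk (i + 1) := fun h => hnot1 i (h ▸ (hmem1 (i + 2)).1)
    have d3 : Fk i ≠ Fk (i + 1) := fun h => hnot1' i (h ▸ hmem2 i)
    have hsub : ({F, Fk i, Fk (i + 1)} : Set (Set (Fin 3 → ℝ))) ⊆ T := by
      rintro G (rfl | rfl | rfl)
      · exact ⟨hF, (hmem1 i).1⟩
      · exact ⟨hfac i, hmem0 i⟩
      · exact ⟨hfac (i + 1), (hmem1 i).2⟩
    have hc3 : ({F, Fk i, Fk (i + 1)} : Set (Set (Fin 3 → ℝ))).ncard = 3 :=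
      Set.ncard_eq_three.mpr ⟨F, Fk i, Fk (i + 1), d1, d2, d3, rfl⟩
    have hfin : T.Finite := Set.finite_of_ncard_ne_zero (by rw [hcard]; norm_num)
    have hTeq := Set.eq_of_subset_of_ncard_le hsub (by rw [hc3, hcard]) hfin
    obtain ⟨G, G', hG, hG', hne, hpG, hqG, hpG', hqG'⟩ :=
      edge_two_facets (Vs.finite_toSet.image toR) hP hfull (hedge i).1 (hedge i).2.2
    have m1 : G ∈ T := ⟨hG, hpG⟩
    have m2 : G' ∈ T := ⟨hG', hpG'⟩
    rw [← hTeq] at m1 m2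
    have hQnF := (hedge i).2.1
    rcases m1 with rfl | rfl | rfl
    · exact absurd hqG hQnF
    · rcases m2 with rfl | rfl | rfl
      · exact absurd hqG' hQnF
      · exact absurd rfl hne
      · exact ⟨hqG, hqG'⟩
    · rcases m2 with rfl | rfl | rfl
      · exact absurd hqG' hQnF
      · exact ⟨hqG', hqG⟩
      · exact absurd rfl hne
  exact
    { prim := hvF.1
      ha := fun i => heq hF hvF _ (hmem1 i).1 _ (hmem1 (i + 1)).1
      hb := fun i => heq (hfac _) (hnor _) _ (hmem1 i).2 _ (hmem2 i)
      hc := fun i => hlt (hfac i) (hnor i) _ (hmem0 i) _ (hPP _) (hnot1' i)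
      hd := fun i => by
        have := hlt (hfac (i + 2)) (hnor (i + 2)) _ (hmem1 (i + 1)).2 _ (hPP i) (hnot2 i)
        rw [inner3_sub] at this ⊢
        linarith
      he1 := fun i => heq (hfac i) (hnor i) _ (hmem0 i) _ (hQF i).1
      he2 := fun i => heq (hfac _) (hnor _) _ (hmem1 i).2 _ (hQF i).2
      he3 := fun i => (hlt hF hvF _ (hmem1 i).1 _ (hQP i) (hedge i).2.1).ne' }


/-- For a facet `F` of a 3-dimensional simple integral convex polytope `P ⊂ ℝ³`, the
rational number `C(F)` computed from a labeling of the vertices and adjacent facets of `F`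
is unchanged under any cyclic rotation of the labeling; i.e. `C(F)` does not depend on
which adjacent facet is chosen as `F_{k_1}`. -/
theorem CFacet_rotation_invariant
    (Vs : Finset (Fin 3 → ℤ)) (hVs : Vs.Nonempty)
    (P : Set (Fin 3 → ℝ)) (hP : P = convexHull ℝ (toR '' (Vs : Set (Fin 3 → ℤ))))
    (hfull : affineSpan ℝ P = ⊤) (hsimple : IsSimple P)
    (F : Set (Fin 3 → ℝ)) (hF : IsFacetOf P F)
    (vF : Fin 3 → ℤ) (hvF : IsInwardNormal P F vF)
    (r : ℕ) (Pt : ℕ → Fin 3 → ℤ) (Fk : ℕ → Set (Fin 3 → ℝ)) (vk : ℕ → Fin 3 → ℤ)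
    (Q : ℕ → Fin 3 → ℝ)
    (hlab : FacetLabeling P F vF r Pt Fk vk Q) (t : ℕ) :
    CFacet vF (fun i => Pt (i + t)) (fun i => vk (i + t)) (fun i => Q (i + t)) r =
      CFacet vF Pt vk Q r := by
  have h := facts_of_labeling Vs P hP hfull hsimple F hF vF hvF r Pt Fk vk Q hlab
  exact h.rotation (le_trans (by norm_num) hlab.three_le) hlab.Pt_periodic hlab.vk_periodic t

end
end

section
/- Let a and c be positive integers and b a nonnegative integer, and put g = gcd(b, c). Let P ⊂ ℝ³ be the convex hull of the six points (0,0,0), (a,0,0), (0,a,0), (b,0,c), (a+b,0,c), (b,a,c). Then for every nonnegative integer l, |(lP) ∩ ℤ³| = (a²c/2)·l³ + ((a² + ac + 2ag)/2)·l² + (3a/2 + g)·l + 1. -/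
open scoped Pointwise

/-- The number of lattice points of the dilated polytope `lP`, i.e. `|(lP) ∩ ℤ³|`. -/
noncomputable def latticeCount (P : Set (Fin 3 → ℝ)) (l : ℕ) : ℕ :=
  Set.ncard {p : Fin 3 → ℤ | (fun i => (p i : ℝ)) ∈ (l : ℝ) • P}

lemma ep_hull (a b c : ℝ) (ha : 0 < a) (hc : 0 < c) (x : Fin 3 → ℝ) :
    x ∈ convexHull ℝ
          {![(0 : ℝ), 0, 0], ![a, 0, 0], ![0, a, 0],
            ![b, 0, c], ![a + b, 0, c], ![b, a, c]} ↔
    (0 ≤ x 2 ∧ x 2 ≤ c ∧ 0 ≤ x 1 ∧ b * x 2 ≤ c * x 0 ∧ c * x 0 + c * x 1 ≤ b * x 2 + a * c) := by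
  constructor
  · intro hx
    have key : convexHull ℝ
          {![(0 : ℝ), 0, 0], ![a, 0, 0], ![0, a, 0],
            ![b, 0, c], ![a + b, 0, c], ![b, a, c]} ⊆
        {x : Fin 3 → ℝ | 0 ≤ x 2 ∧ x 2 ≤ c ∧ 0 ≤ x 1 ∧ b * x 2 ≤ c * x 0 ∧
          c * x 0 + c * x 1 ≤ b * x 2 + a * c} := by
      apply convexHull_min
      · have h1 : 0 < c * a := mul_pos hc ha
        intro y hy
        simp only [Set.mem_insert_iff, Set.mem_singleton_iff] at hy
        rcases hy with h | h | h | h | h | h <;> subst h <;>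
          simp <;> refine ⟨?_, ?_⟩ <;> (try constructor) <;> (try constructor) <;> nlinarith
      · rintro x ⟨h1, h2, h3, h4, h5⟩ y ⟨k1, k2, k3, k4, k5⟩ s t hs ht hst
        obtain rfl : s = 1 - t := by linarith
        simp only [Set.mem_ofPred_eq, Pi.add_apply, Pi.smul_apply, smul_eq_mul]
        refine ⟨by positivity, by nlinarith, by positivity, ?_, ?_⟩
        · nlinarith [mul_le_mul_of_nonneg_left h4 hs, mul_le_mul_of_nonneg_left k4 ht]
        · nlinarith [mul_le_mul_of_nonneg_left h5 hs, mul_le_mul_of_nonneg_left k5 ht]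
    exact key hx
  · rintro ⟨h1, h2, h3, h4, h5⟩
    set S : Set (Fin 3 → ℝ) := {![(0 : ℝ), 0, 0], ![a, 0, 0], ![0, a, 0],
            ![b, 0, c], ![a + b, 0, c], ![b, a, c]} with hS
    obtain ⟨t, ht⟩ : ∃ t, x 2 = c * t := ⟨x 2 / c, by field_simp⟩
    obtain ⟨u, hu⟩ : ∃ u, x 0 = b * t + a * u := ⟨(x 0 - b * t) / a, by field_simp; ring⟩
    obtain ⟨v, hv⟩ : ∃ v, x 1 = a * v := ⟨x 1 / a, by field_simp⟩
    have hca : 0 < c * a := mul_pos hc ha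
    have t0 : 0 ≤ t := by
      rw [ht] at h1; exact nonneg_of_mul_nonneg_right h1 hc
    have t1 : 0 ≤ 1 - t := by
      have : 0 ≤ c * (1 - t) := by linarith
      exact nonneg_of_mul_nonneg_right this hc
    have v0 : 0 ≤ v := by
      rw [hv] at h3; exact nonneg_of_mul_nonneg_right h3 ha
    have u0 : 0 ≤ u := by
      have : 0 ≤ (c * a) * u := by rw [hu, ht] at h4; linarith
      exact nonneg_of_mul_nonneg_right this hca
    have w0 : 0 ≤ 1 - u - v := by
      have : 0 ≤ (c * a) * (1 - u - v) := by rw [hu, ht, hv] at h5; linarith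
      exact nonneg_of_mul_nonneg_right this hca
    have := (convex_convexHull ℝ S).sum_mem (t := (Finset.univ : Finset (Fin 6)))
      (w := ![(1 - t) * (1 - u - v), (1 - t) * u, (1 - t) * v, t * (1 - u - v), t * u, t * v])
      (z := ![![(0 : ℝ), 0, 0], ![a, 0, 0], ![0, a, 0],
            ![b, 0, c], ![a + b, 0, c], ![b, a, c]])
      (by intro i _; fin_cases i <;> simp <;> positivity)
      (by simp [Fin.sum_univ_six]; ring)
      (by intro i _; apply subset_convexHull; fin_cases i <;> simp [hS])
    convert this using 1
    ext i
    fin_cases i <;> simp [Fin.sum_univ_six, ht, hu, hv] <;> ring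

lemma ep_mem (a b c l : ℕ) (ha : 0 < a) (hc : 0 < c) (p : Fin 3 → ℤ) :
    (fun i => (p i : ℝ)) ∈ (l : ℝ) • (convexHull ℝ
          {![(0 : ℝ), 0, 0], ![(a : ℝ), 0, 0], ![0, (a : ℝ), 0],
            ![(b : ℝ), 0, (c : ℝ)], ![(a : ℝ) + (b : ℝ), 0, (c : ℝ)],
            ![(b : ℝ), (a : ℝ), (c : ℝ)]}) ↔
    (0 ≤ p 2 ∧ p 2 ≤ c * l ∧ 0 ≤ p 1 ∧ b * p 2 ≤ c * p 0 ∧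
      c * p 0 + c * p 1 ≤ b * p 2 + c * (a * l)) := by
  have ha' : (0 : ℝ) < a := by exact_mod_cast ha
  have hc' : (0 : ℝ) < c := by exact_mod_cast hc
  rcases Nat.eq_zero_or_pos l with rfl | hl
  · rw [Nat.cast_zero, Set.zero_smul_set ⟨_, subset_convexHull _ _ (Set.mem_insert _ _)⟩]
    have hc2 : (0 : ℤ) < c := by exact_mod_cast hc
    constructor
    · intro h
      have h' : ∀ i, p i = 0 := fun i => by
        have := congrFun (Set.mem_zero.1 h) i
        simpa using this
      simp [h']
    · rintro ⟨h1, h2, h3, h4, h5⟩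
      have e2 : p 2 = 0 := by push_cast at h2; linarith
      rw [e2] at h4 h5
      have h0 : 0 ≤ p 0 := by
        apply nonneg_of_mul_nonneg_right _ hc2; linarith
      have h6 : 0 ≤ - p 0 - p 1 := by
        apply nonneg_of_mul_nonneg_right _ hc2; push_cast at h5; linarith
      have e0 : p 0 = 0 := by omega
      have e1 : p 1 = 0 := by omega
      rw [Set.mem_zero]
      ext i
      fin_cases i <;> simp [e0, e1, e2]
  · have hl' : (0 : ℝ) < l := by exact_mod_cast hl
    rw [Set.mem_smul_set_iff_inv_smul_mem₀ hl'.ne', ep_hull _ _ _ ha' hc']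
    simp only [Pi.smul_apply, smul_eq_mul]
    have e : ∀ r : ℝ, (l : ℝ)⁻¹ * r = r / l := fun r => by field_simp
    simp only [e]
    have i1 : (0 ≤ (p 2 : ℝ) / l) ↔ 0 ≤ p 2 := by
      rw [le_div_iff₀ hl', zero_mul]; exact_mod_cast Iff.rfl
    have i3 : (0 ≤ (p 1 : ℝ) / l) ↔ 0 ≤ p 1 := by
      rw [le_div_iff₀ hl', zero_mul]; exact_mod_cast Iff.rfl
    have i2 : ((p 2 : ℝ) / l ≤ c) ↔ p 2 ≤ c * l := by
      rw [div_le_iff₀ hl']; exact_mod_cast Iff.rfl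
    have i4 : ((b : ℝ) * ((p 2 : ℝ) / l) ≤ c * ((p 0 : ℝ) / l)) ↔ b * p 2 ≤ c * p 0 := by
      rw [← mul_div_assoc, ← mul_div_assoc, div_le_div_iff_of_pos_right hl']
      exact_mod_cast Iff.rfl
    have i5 : ((c : ℝ) * ((p 0 : ℝ) / l) + c * ((p 1 : ℝ) / l) ≤
        b * ((p 2 : ℝ) / l) + a * c) ↔ c * p 0 + c * p 1 ≤ b * p 2 + c * (a * l) := by
      have : (b : ℝ) * ((p 2 : ℝ) / l) + a * c = (b * p 2 + c * (a * l)) / l := by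
        field_simp
      rw [this, ← mul_div_assoc, ← mul_div_assoc, ← add_div, div_le_div_iff_of_pos_right hl']
      exact_mod_cast Iff.rfl
    rw [i1, i2, i3, i4, i5]

lemma ep_dvd_count (b c l : ℕ) (hc : 0 < c) :
    ((Finset.range (c * l + 1)).filter (fun z => c ∣ b * z)).card = Nat.gcd b c * l + 1 := by
  obtain ⟨g, b', c', hg, hcop, hb, hcc⟩ := Nat.exists_coprime' (m := b) (n := c)
    (Nat.gcd_pos_of_pos_right _ hc)
  have hgg : Nat.gcd b c = g := by
    rw [hb, hcc, Nat.gcd_mul_right, hcop.gcd_eq_one, one_mul]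
  rw [hgg]
  have hc' : 0 < c' := by
    rcases Nat.eq_zero_or_pos c' with h | h
    · subst h; omega
    · exact h
  have : (Finset.range (c * l + 1)).filter (fun z => c ∣ b * z) =
      (Finset.range (g * l + 1)).image (fun k => c' * k) := by
    ext z
    simp only [Finset.mem_filter, Finset.mem_range, Finset.mem_image]
    constructor
    · rintro ⟨h1, h2⟩
      have h3 : c' ∣ z := by
        rw [hb, hcc, mul_comm c' g, mul_comm b' g, mul_assoc] at h2
        exact hcop.symm.dvd_of_dvd_mul_left (Nat.dvd_of_mul_dvd_mul_left hg h2)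
      obtain ⟨k, rfl⟩ := h3
      refine ⟨k, ?_, rfl⟩
      have : c' * k ≤ c' * (g * l) := by
        rw [← mul_assoc, ← hcc]; omega
      have := Nat.le_of_mul_le_mul_left this hc'
      omega
    · rintro ⟨k, hk, rfl⟩
      constructor
      · have : c' * k ≤ c' * (g * l) := Nat.mul_le_mul_left _ (by omega)
        rw [← mul_assoc, ← hcc] at this; omega
      · rw [hb, hcc]; exact ⟨b' * k, by ring⟩
  rw [this, Finset.card_image_of_injective _ (fun x y h => Nat.eq_of_mul_eq_mul_left hc' h),
    Finset.card_range]

/-- `0` if `c` divides `b z`, and `1` otherwise. -/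
def epE (b c z : ℕ) : ℕ := if c ∣ b * z then 0 else 1

/-- Index set `(z, s, y)`. -/
def epF (b c l n : ℕ) : Finset (Σ _ : ℕ, Σ _ : ℕ, ℕ) :=
  (Finset.range (c * l + 1)).sigma fun z =>
    (Finset.range (n + 1 - epE b c z)).sigma fun s => Finset.range (s + 1)

/-- The parametrization of the lattice points. -/
def epf (b c : ℕ) (q : Σ _ : ℕ, Σ _ : ℕ, ℕ) : Fin 3 → ℤ :=
  ![(q.2.1 : ℤ) - q.2.2 + (b * q.1 / c : ℕ) + epE b c q.1, q.2.2, q.1]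

lemma epf_inj (b c : ℕ) : Function.Injective (epf b c) := by
  rintro ⟨z, s, y⟩ ⟨z', s', y'⟩ h
  have h0 := congrFun h 0
  have h1 := congrFun h 1
  have h2 := congrFun h 2
  simp only [epf, Matrix.cons_val] at h0 h1 h2
  obtain rfl : y = y' := by exact_mod_cast h1
  obtain rfl : z = z' := by exact_mod_cast h2
  obtain rfl : s = s' := by omega
  rfl

lemma ep_lo (b c z : ℕ) (hc : 0 < c) (x : ℤ) :
    (b : ℤ) * z ≤ c * x ↔ ((b * z / c : ℕ) : ℤ) + epE b c z ≤ x := by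
  have hc2 : (0 : ℤ) < c := by exact_mod_cast hc
  have hdm : (c : ℤ) * (b * z / c : ℕ) + (b * z % c : ℕ) = b * z := by
    exact_mod_cast Nat.div_add_mod (b * z) c
  have hlt : ((b * z % c : ℕ) : ℤ) < c := by exact_mod_cast Nat.mod_lt _ hc
  generalize (b * z / c : ℕ) = q at *
  unfold epE
  split_ifs with h
  · rw [Nat.mod_eq_zero_of_dvd h] at hdm
    rw [← hdm]
    simp only [Nat.cast_zero, add_zero]
    exact mul_le_mul_iff_right₀ hc2
  · have hpos : (0 : ℤ) < (b * z % c : ℕ) := by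
      have := Nat.pos_of_ne_zero (fun h' => h (Nat.dvd_of_mod_eq_zero h'))
      exact_mod_cast this
    rw [← hdm]
    constructor
    · intro h1
      have : (c : ℤ) * q < c * x := by linarith
      have := lt_of_mul_lt_mul_left this hc2.le
      push_cast; omega
    · intro h1
      push_cast at h1
      nlinarith

lemma ep_hi (b c z : ℕ) (hc : 0 < c) (x : ℤ) :
    c * x ≤ (b : ℤ) * z ↔ x ≤ ((b * z / c : ℕ) : ℤ) := by
  have hc2 : (0 : ℤ) < c := by exact_mod_cast hc
  rw [Int.natCast_div, Int.le_ediv_iff_mul_le hc2, mul_comm, Nat.cast_mul]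

lemma epF_card (b c l n : ℕ) (hc : 0 < c) :
    ((epF b c l n).card : ℚ) =
      ((c : ℚ) * l + 1) * (n * (n + 1) / 2) + ((Nat.gcd b c : ℚ) * l + 1) * (n + 1) := by
  have tri : ∀ N : ℕ, ((∑ s ∈ Finset.range N, (s + 1) : ℕ) : ℚ) = N * (N + 1) / 2 := by
    intro N
    induction N with
    | zero => simp
    | succ k ih => rw [Finset.sum_range_succ, Nat.cast_add, ih]; push_cast; ring
  have h1 : (epF b c l n).card = ∑ z ∈ Finset.range (c * l + 1),
      ∑ s ∈ Finset.range (n + 1 - epE b c z), (s + 1) := by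
    simp [epF, Finset.card_sigma]
  rw [h1, Nat.cast_sum]
  have h2 : ∀ z ∈ Finset.range (c * l + 1),
      ((∑ s ∈ Finset.range (n + 1 - epE b c z), (s + 1) : ℕ) : ℚ) =
      (n : ℚ) * (n + 1) / 2 + if c ∣ b * z then ((n : ℚ) + 1) else 0 := by
    intro z _
    rw [tri]
    unfold epE
    split_ifs
    · push_cast; ring
    · simp
  rw [Finset.sum_congr rfl h2, Finset.sum_add_distrib, ← Finset.sum_filter, Finset.sum_const,
    Finset.sum_const, ep_dvd_count b c l hc, Finset.card_range]
  simp only [nsmul_eq_mul]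
  push_cast
  ring

lemma ep_set (a b c l : ℕ) (ha : 0 < a) (hc : 0 < c) :
    {p : Fin 3 → ℤ | (fun i => (p i : ℝ)) ∈ (l : ℝ) • (convexHull ℝ
          {![(0 : ℝ), 0, 0], ![(a : ℝ), 0, 0], ![0, (a : ℝ), 0],
            ![(b : ℝ), 0, (c : ℝ)], ![(a : ℝ) + (b : ℝ), 0, (c : ℝ)],
            ![(b : ℝ), (a : ℝ), (c : ℝ)]})} =
    Set.image (epf b c) (epF b c l (a * l) : Set _) := by
  ext p
  rw [Set.mem_ofPred_eq, ep_mem a b c l ha hc]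
  have hE : ∀ z, epE b c z ≤ 1 := fun z => by unfold epE; split_ifs <;> simp
  constructor
  · rintro ⟨h1, h2, h3, h4, h5⟩
    obtain ⟨z, hz⟩ := Int.eq_ofNat_of_zero_le h1
    obtain ⟨y, hy⟩ := Int.eq_ofNat_of_zero_le h3
    rw [hz] at h2 h4 h5
    rw [hy] at h5
    rw [ep_lo b c z hc] at h4
    have h5' : (c : ℤ) * (p 0 + y - (a * l : ℕ)) ≤ b * z := by push_cast; linarith
    rw [ep_hi b c z hc] at h5'
    have hz' : z ≤ c * l := by exact_mod_cast h2
    have hEz := hE z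
    obtain ⟨s, hs⟩ : ∃ s : ℕ, (s : ℤ) = p 0 - (b * z / c : ℕ) - epE b c z + y :=
      ⟨(p 0 - (b * z / c : ℕ) - epE b c z + y).toNat, by omega⟩
    refine ⟨⟨z, s, y⟩, ?_, ?_⟩
    · simp only [epF, Finset.coe_sigma, Set.mem_sigma_iff, Finset.mem_coe,
        Finset.mem_range]
      generalize a * l = n at *
      refine ⟨by omega, by omega, by omega⟩
    · ext i
      fin_cases i
      · change (s : ℤ) - y + (b * z / c : ℕ) + epE b c z = p 0
        omega
      · simp [epf, hy]
      · simp [epf, hz]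
  · rintro ⟨⟨z, s, y⟩, hq, rfl⟩
    rw [Finset.mem_coe] at hq
    simp only [epF, Finset.mem_sigma, Finset.mem_range] at hq
    obtain ⟨h1, h2, h3⟩ := hq
    have hEz := hE z
    have e0 : epf b c ⟨z, s, y⟩ 0 = (s : ℤ) - y + (b * z / c : ℕ) + epE b c z := rfl
    have e1 : epf b c ⟨z, s, y⟩ 1 = y := rfl
    have e2 : epf b c ⟨z, s, y⟩ 2 = z := rfl
    rw [e1, e2]
    refine ⟨by omega, by exact_mod_cast Nat.lt_succ_iff.1 h1, by omega, ?_, ?_⟩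
    · rw [ep_lo b c z hc, e0]; omega
    · have : (c : ℤ) * (epf b c ⟨z, s, y⟩ 0 + y - (a * l : ℕ)) ≤ b * z := by
        rw [ep_hi b c z hc, e0]
        generalize a * l = n at *
        omega
      push_cast at this
      linarith

/-- For the prism-like simple polytope `P = conv{(0,0,0), (a,0,0), (0,a,0), (b,0,c),
(a+b,0,c), (b,a,c)}` with `a, c > 0`, `b ≥ 0` and `g = gcd(b,c)`, the Ehrhart polynomial is
`|(lP) ∩ ℤ³| = (a²c/2) l³ + ((a² + ac + 2ag)/2) l² + (3a/2 + g) l + 1`. -/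
theorem ehrhart_prism (a c b : ℕ) (ha : 0 < a) (hc : 0 < c) :
    ∀ l : ℕ,
      (latticeCount (convexHull ℝ
          {![(0 : ℝ), 0, 0], ![(a : ℝ), 0, 0], ![0, (a : ℝ), 0],
            ![(b : ℝ), 0, (c : ℝ)], ![(a : ℝ) + (b : ℝ), 0, (c : ℝ)],
            ![(b : ℝ), (a : ℝ), (c : ℝ)]}) l : ℚ) =
        ((a : ℚ) ^ 2 * (c : ℚ) / 2) * (l : ℚ) ^ 3 +
          (((a : ℚ) ^ 2 + (a : ℚ) * (c : ℚ) + 2 * (a : ℚ) * (Nat.gcd b c : ℚ)) / 2) *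
            (l : ℚ) ^ 2 +
          (3 * (a : ℚ) / 2 + (Nat.gcd b c : ℚ)) * (l : ℚ) + 1 := by
  intro l
  rw [latticeCount, ep_set a b c l ha hc, Set.ncard_image_of_injective _ (epf_inj b c),
    Set.ncard_coe_finset, epF_card b c l _ hc]
  push_cast
  ring
end

section
/- Let a and c be positive integers and b a nonnegative integer, put g = gcd(b, c), and let P ⊂ ℝ³ be the convex hull of the six points (0,0,0), (a,0,0), (0,a,0), (b,0,c), (a+b,0,c), (b,a,c). Then for every nonnegative integer l and every integer z with 0 ≤ z ≤ cl, the number of pairs (x, y) ∈ ℤ² with (x, y, z) ∈ lP equals (al+1)(al+2)/2 if (c/g) divides z, and equals al(al+1)/2 otherwise. -/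
open scoped Pointwise

lemma tri_count (r : ℤ) (M : ℕ) :
    (Set.ncard {p : ℤ × ℤ | r ≤ p.1 ∧ 0 ≤ p.2 ∧ p.1 + p.2 < r + M} : ℚ) = (M : ℚ) * (M + 1) / 2 := by
  have h : {p : ℤ × ℤ | r ≤ p.1 ∧ 0 ≤ p.2 ∧ p.1 + p.2 < r + M} =
      (((Finset.range M).sigma (fun k => Finset.range (k + 1))).image
        (fun s : (Σ _ : ℕ, ℕ) => ((r + s.2, (s.1 : ℤ) - s.2) : ℤ × ℤ)) : Finset (ℤ × ℤ)) := by
    ext ⟨x, y⟩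
    simp only [Set.mem_ofPred_eq, Finset.coe_image, Set.mem_image, Finset.mem_coe,
      Finset.mem_sigma, Finset.mem_range, Prod.mk.injEq]
    constructor
    · rintro ⟨h1, h2, h3⟩
      refine ⟨⟨(x - r + y).toNat, (x - r).toNat⟩, ⟨?_, ?_⟩, ?_, ?_⟩ <;> dsimp only <;> omega
    · rintro ⟨⟨k, i⟩, ⟨h1, h2⟩, h3, h4⟩
      dsimp only at *
      omega
  rw [h, Set.ncard_coe_finset, Finset.card_image_of_injective]
  · rw [Finset.card_sigma]
    simp only [Finset.card_range]
    clear h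
    induction M with
    | zero => simp
    | succ n ih =>
      rw [Finset.sum_range_succ, Nat.cast_add, ih]
      push_cast
      ring
  · rintro ⟨k, i⟩ ⟨k', i'⟩ h
    simp only [Prod.mk.injEq] at h
    obtain ⟨h1, h2⟩ := h
    have e1 : i = i' := by omega
    have e2 : k = k' := by omega
    subst e1 e2
    rfl

lemma three_mem {s : Set (Fin 3 → ℝ)} (hs : Convex ℝ s) {p q r : Fin 3 → ℝ} (hp : p ∈ s)
    (hq : q ∈ s) (hr : r ∈ s) {u v w : ℝ} (hu : 0 ≤ u) (hv : 0 ≤ v) (hw : 0 ≤ w)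
    (h : u + v + w = 1) : u • p + v • q + w • r ∈ s := by
  have := hs.sum_mem (t := Finset.univ) (w := ![u, v, w]) (z := ![p, q, r])
    (by intro i _; fin_cases i <;> simpa) (by simpa [Fin.sum_univ_three] using h)
    (by intro i _; fin_cases i <;> simpa)
  simpa [Fin.sum_univ_three] using this

lemma mem_hull (a b c : ℝ) (ha : 0 < a) (hc : 0 < c) (x y z : ℝ) :
    ![x, y, z] ∈ convexHull ℝ
          {![(0 : ℝ), 0, 0], ![a, 0, 0], ![0, a, 0],
            ![b, 0, c], ![a + b, 0, c], ![b, a, c]} ↔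
    0 ≤ z ∧ z ≤ c ∧ 0 ≤ y ∧ b * z ≤ c * x ∧ c * x + c * y ≤ b * z + c * a := by
  constructor
  · intro h
    have hsub : convexHull ℝ
          {![(0 : ℝ), 0, 0], ![a, 0, 0], ![0, a, 0],
            ![b, 0, c], ![a + b, 0, c], ![b, a, c]} ⊆
        {p : Fin 3 → ℝ | 0 ≤ p 2 ∧ p 2 ≤ c ∧ 0 ≤ p 1 ∧ b * p 2 ≤ c * p 0 ∧
          c * p 0 + c * p 1 ≤ b * p 2 + c * a} := by
      apply convexHull_min
      · have := mul_pos ha hc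
        intro p hp
        simp only [Set.mem_insert_iff, Set.mem_singleton_iff] at hp
        rcases hp with rfl | rfl | rfl | rfl | rfl | rfl <;>
          simp only [Set.mem_ofPred_eq, Matrix.cons_val] <;>
          refine ⟨?_, ?_, ?_, ?_, ?_⟩ <;> nlinarith
      · intro p hp q hq s t hs ht hst
        obtain ⟨p1, p2, p3, p4, p5⟩ := hp
        obtain ⟨q1, q2, q3, q4, q5⟩ := hq
        obtain rfl : t = 1 - s := by linarith
        simp only [Set.mem_ofPred_eq, Pi.add_apply, Pi.smul_apply, smul_eq_mul]
        refine ⟨?_, ?_, ?_, ?_, ?_⟩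
        · positivity
        · nlinarith [mul_le_mul_of_nonneg_left p2 hs, mul_le_mul_of_nonneg_left q2 ht]
        · positivity
        · nlinarith [mul_le_mul_of_nonneg_left p4 hs, mul_le_mul_of_nonneg_left q4 ht]
        · nlinarith [mul_le_mul_of_nonneg_left p5 hs, mul_le_mul_of_nonneg_left q5 ht]
    simpa using hsub h
  · rintro ⟨h1, h2, h3, h4, h5⟩
    set S : Set (Fin 3 → ℝ) := {![(0 : ℝ), 0, 0], ![a, 0, 0], ![0, a, 0],
            ![b, 0, c], ![a + b, 0, c], ![b, a, c]} with hS
    have hcv := convex_convexHull ℝ S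
    have hm : ∀ p ∈ S, p ∈ convexHull ℝ S := fun p hp => subset_convexHull ℝ S hp
    obtain ⟨t, rfl⟩ : ∃ t, z = c * t := ⟨z / c, by field_simp⟩
    obtain ⟨u, rfl⟩ : ∃ u, x = a * u + b * t := ⟨(x - b * t) / a, by field_simp; ring⟩
    obtain ⟨v, rfl⟩ : ∃ v, y = a * v := ⟨y / a, by field_simp⟩
    have hca := mul_pos hc ha
    have t0 : 0 ≤ t := nonneg_of_mul_nonneg_right h1 hc
    have t1 : t ≤ 1 := le_of_mul_le_mul_left (by linarith) hc
    have v0 : 0 ≤ v := nonneg_of_mul_nonneg_right h3 ha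
    have u0 : 0 ≤ u := nonneg_of_mul_nonneg_right (a := c * a) (by nlinarith) hca
    have w0 : u + v ≤ 1 := le_of_mul_le_mul_left (a := c * a) (by nlinarith) hca
    have A := three_mem hcv (hm ![(0 : ℝ), 0, 0] (by simp [hS])) (hm ![a, 0, 0] (by simp [hS]))
      (hm ![0, a, 0] (by simp [hS])) (u := 1 - u - v) (by linarith) u0 v0 (by ring)
    have B := three_mem hcv (hm ![b, 0, c] (by simp [hS])) (hm ![a + b, 0, c] (by simp [hS]))
      (hm ![b, a, c] (by simp [hS])) (u := 1 - u - v) (by linarith) u0 v0 (by ring)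
    have C := hcv A B (a := 1 - t) (b := t) (by linarith) t0 (by ring)
    convert C using 1
    ext i
    fin_cases i <;> simp <;> ring

lemma mem_smul_hull (a b c : ℝ) (ha : 0 < a) (hc : 0 < c) (l : ℝ) (hl : 0 ≤ l) (x y z : ℝ) :
    ![x, y, z] ∈ l • convexHull ℝ
          {![(0 : ℝ), 0, 0], ![a, 0, 0], ![0, a, 0],
            ![b, 0, c], ![a + b, 0, c], ![b, a, c]} ↔
    0 ≤ z ∧ z ≤ c * l ∧ 0 ≤ y ∧ b * z ≤ c * x ∧ c * x + c * y ≤ b * z + c * (a * l) := by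
  rcases hl.eq_or_lt with rfl | hl
  · rw [Set.zero_smul_set (by simp)]
    simp only [Set.mem_zero]
    constructor
    · intro h
      have h0 := congrFun h 0
      have h1 := congrFun h 1
      have h2 := congrFun h 2
      simp at h0 h1 h2
      subst h0 h1 h2
      simp
    · rintro ⟨h1, h2, h3, h4, h5⟩
      obtain rfl : z = 0 := by linarith
      have hy : 0 ≤ c * y := by positivity
      have hx : x = 0 := by
        have : c * x = 0 := by linarith
        simpa [hc.ne'] using this
      have hy : y = 0 := by
        have : c * y = 0 := by linarith
        simpa [hc.ne'] using this
      subst hx hy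
      ext i
      fin_cases i <;> simp
  · rw [Set.mem_smul_set_iff_inv_smul_mem₀ hl.ne']
    have : l⁻¹ • ![x, y, z] = ![x / l, y / l, z / l] := by
      ext i
      fin_cases i <;> simp [div_eq_inv_mul]
    rw [this, mem_hull a b c ha hc]
    obtain ⟨x, rfl⟩ : ∃ x', x = l * x' := ⟨x / l, by field_simp⟩
    obtain ⟨y, rfl⟩ : ∃ x', y = l * x' := ⟨y / l, by field_simp⟩
    obtain ⟨z, rfl⟩ : ∃ x', z = l * x' := ⟨z / l, by field_simp⟩
    simp only [mul_div_cancel_left₀ _ hl.ne']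
    have e1 : 0 ≤ l * z ↔ 0 ≤ z := mul_nonneg_iff_of_pos_left hl
    have e2 : 0 ≤ l * y ↔ 0 ≤ y := mul_nonneg_iff_of_pos_left hl
    have e3 : l * z ≤ c * l ↔ z ≤ c := by rw [mul_comm c l, mul_le_mul_iff_right₀ hl]
    have e4 : b * (l * z) ≤ c * (l * x) ↔ b * z ≤ c * x := by
      rw [mul_left_comm b, mul_left_comm c, mul_le_mul_iff_right₀ hl]
    have e5 : c * (l * x) + c * (l * y) ≤ b * (l * z) + c * (a * l) ↔
        c * x + c * y ≤ b * z + c * a := by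
      rw [← mul_le_mul_iff_right₀ (a := l) (b := c * x + c * y) hl]
      ring_nf
    rw [e1, e2, e3, e4, e5]

lemma dvd_iff_aux (b c : ℕ) (hc : 0 < c) (z : ℤ) :
    ((c / Nat.gcd b c : ℕ) : ℤ) ∣ z ↔ (c : ℤ) ∣ b * z := by
  have hg : 0 < Nat.gcd b c := Nat.gcd_pos_of_pos_right b hc
  obtain ⟨g, b', c', hg', hcop, rfl, rfl⟩ := Nat.exists_coprime' hg
  have : Nat.gcd (b' * g) (c' * g) = g := by rw [Nat.gcd_mul_right, hcop, one_mul]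
  rw [this, Nat.mul_div_cancel _ hg']
  push_cast
  rw [show (b' : ℤ) * g * z = (b' * z) * g by ring,
    mul_dvd_mul_iff_right (by exact_mod_cast hg'.ne')]
  have hco : IsCoprime (c' : ℤ) (b' : ℤ) := (Nat.isCoprime_iff_coprime.mpr hcop).symm
  exact ⟨fun h => h.mul_left _, fun h => hco.dvd_of_dvd_mul_left h⟩



/-- For the prism-like simple polytope `P = conv{(0,0,0), (a,0,0), (0,a,0), (b,0,c),
(a+b,0,c), (b,a,c)}` with `a, c > 0`, `b ≥ 0` and `g = gcd(b,c)`, for every nonnegative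
integer `l` and every integer `z` with `0 ≤ z ≤ cl`, the number of pairs `(x, y) ∈ ℤ²` with
`(x, y, z) ∈ lP` is `(al+1)(al+2)/2` if `(c/g) ∣ z` and `al(al+1)/2` otherwise. -/
theorem slice_count_prism (a c b : ℕ) (ha : 0 < a) (hc : 0 < c) (l : ℕ) (z : ℤ)
    (hz0 : 0 ≤ z) (hzc : z ≤ (c : ℤ) * (l : ℤ)) :
    (Set.ncard {p : ℤ × ℤ | ![(p.1 : ℝ), (p.2 : ℝ), (z : ℝ)] ∈
        (l : ℝ) • (convexHull ℝ
          {![(0 : ℝ), 0, 0], ![(a : ℝ), 0, 0], ![0, (a : ℝ), 0],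
            ![(b : ℝ), 0, (c : ℝ)], ![(a : ℝ) + (b : ℝ), 0, (c : ℝ)],
            ![(b : ℝ), (a : ℝ), (c : ℝ)]})} : ℚ) =
      if ((c / Nat.gcd b c : ℕ) : ℤ) ∣ z then
        ((a : ℚ) * l + 1) * ((a : ℚ) * l + 2) / 2
      else
        (a : ℚ) * l * ((a : ℚ) * l + 1) / 2 := by
  have hset : ∀ p : ℤ × ℤ, ![(p.1 : ℝ), (p.2 : ℝ), (z : ℝ)] ∈
        (l : ℝ) • (convexHull ℝ
          {![(0 : ℝ), 0, 0], ![(a : ℝ), 0, 0], ![0, (a : ℝ), 0],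
            ![(b : ℝ), 0, (c : ℝ)], ![(a : ℝ) + (b : ℝ), 0, (c : ℝ)],
            ![(b : ℝ), (a : ℝ), (c : ℝ)]}) ↔
      0 ≤ p.2 ∧ (b : ℤ) * z ≤ c * p.1 ∧ (c : ℤ) * p.1 + c * p.2 ≤ b * z + c * (a * l) := by
    intro p
    rw [mem_smul_hull _ _ _ (by exact_mod_cast ha) (by exact_mod_cast hc) _ (by positivity)]
    norm_cast
    simp [hz0, hzc]
  simp only [hset]
  have hc' : (0 : ℤ) < c := by exact_mod_cast hc
  by_cases h : (c : ℤ) ∣ b * z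
  · rw [if_pos ((dvd_iff_aux b c hc z).mpr h)]
    obtain ⟨q, hq⟩ := h
    have := tri_count q (a * l + 1)
    convert this using 1
    · congr 2
      ext p
      simp only [Set.mem_ofPred_eq]
      rw [hq, ← mul_add, ← mul_add, mul_le_mul_iff_right₀ hc', mul_le_mul_iff_right₀ hc']
      push_cast
      constructor <;> rintro ⟨h1, h2, h3⟩ <;> refine ⟨?_, ?_, ?_⟩ <;> linarith
    · push_cast
      ring
  · rw [if_neg (fun h' => h ((dvd_iff_aux b c hc z).mp h'))]
    have h1 := Int.emod_add_mul_ediv ((b : ℤ) * z) c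
    have h2 := Int.emod_nonneg ((b : ℤ) * z) hc'.ne'
    have h3 := Int.emod_lt_of_pos ((b : ℤ) * z) hc'
    have h4 : ((b : ℤ) * z) % c ≠ 0 := fun h' => h (Int.dvd_of_emod_eq_zero h')
    have h5 : 0 < ((b : ℤ) * z) % c := lt_of_le_of_ne h2 h4.symm
    set q := ((b : ℤ) * z) / c
    set r := ((b : ℤ) * z) % c
    have := tri_count (q + 1) (a * l)
    convert this using 1
    · congr 2
      ext p
      simp only [Set.mem_ofPred_eq]
      rw [← h1]
      push_cast
      constructor
      · rintro ⟨g1, g2, g3⟩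
        refine ⟨?_, g1, ?_⟩
        · have : q < p.1 := lt_of_mul_lt_mul_left (a := (c : ℤ)) (by linarith) hc'.le
          linarith
        · exact lt_of_mul_lt_mul_left (a := (c : ℤ)) (by linarith) hc'.le
      · rintro ⟨g1, g2, g3⟩
        refine ⟨g2, ?_, ?_⟩
        · have := mul_le_mul_of_nonneg_left g1 hc'.le
          linarith
        · have g4 : p.1 + p.2 ≤ q + a * l := by linarith
          have := mul_le_mul_of_nonneg_left g4 hc'.le
          linarith
    · push_cast
      ring
end
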